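/- arXiv:1309.4505 — 4 statements merged into one kernel-verified Lean document; each statement's English description precedes it below -/
import Mathlib

section
/- Let n ≥ 1, 1 ≤ k ≤ n, and 1 ≤ q ≤ ∞. There exists a constant C = C(n, q) > 0 such that for every θ ∈ C_c^∞(ℝⁿ₊) (smooth, compactly supported in the open half-space), ‖ ∂_k 𝒩(∂ₙθ) ‖_{L^q(ℝⁿ₊)} ≤ C ( ‖ ∂ₙθ ‖_{L^q(ℝⁿ₊)} + ‖ yₙ θ ‖_{L^q(ℝⁿ₊)} ), where yₙθ denotes the function y ↦ yₙ·θ(y). -/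
open MeasureTheory ENNReal

noncomputable section

/-- Points of `ℝⁿ` with `n = m + 1`, written as pairs `x = (x′, xₙ)`. -/
abbrev HalfSpacePt (m : ℕ) := (Fin m → ℝ) × ℝ

/-- The Gauss kernel `G_t(x) = (4πt)^{-n/2} exp(-|x|²/(4t))` in dimension `n = m + 1`. -/
def gauss (m : ℕ) (t : ℝ) (x : HalfSpacePt m) : ℝ :=
  (4 * Real.pi * t) ^ (-((m : ℝ) + 1) / 2) *
    Real.exp (-((∑ i, x.1 i ^ 2) + x.2 ^ 2) / (4 * t))

/-- The open upper half-space `ℝⁿ₊ = {x : xₙ > 0}`. -/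
def halfSpace (m : ℕ) : Set (HalfSpacePt m) := {x | 0 < x.2}

/-- The Dirichlet heat operator
`E(t)f(x) = ∫_{ℝⁿ₊} [G_t(x′−y′, xₙ−yₙ) − G_t(x′−y′, xₙ+yₙ)] f(y) dy`. -/
def Eheat (m : ℕ) (t : ℝ) (f : HalfSpacePt m → ℝ) (x : HalfSpacePt m) : ℝ :=
  ∫ y in halfSpace m,
    (gauss m t (x.1 - y.1, x.2 - y.2) - gauss m t (x.1 - y.1, x.2 + y.2)) * f y

/-- The Neumann heat operator
`F(t)f(x) = ∫_{ℝⁿ₊} [G_t(x′−y′, xₙ−yₙ) + G_t(x′−y′, xₙ+yₙ)] f(y) dy`. -/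
def Fheat (m : ℕ) (t : ℝ) (f : HalfSpacePt m → ℝ) (x : HalfSpacePt m) : ℝ :=
  ∫ y in halfSpace m,
    (gauss m t (x.1 - y.1, x.2 - y.2) + gauss m t (x.1 - y.1, x.2 + y.2)) * f y

/-- The Neumann potential operator `𝒩f(x) = ∫₀^∞ F(τ)f(x) dτ`. -/
def neumannPotential (m : ℕ) (f : HalfSpacePt m → ℝ) (x : HalfSpacePt m) : ℝ :=
  ∫ τ in Set.Ioi (0 : ℝ), Fheat m τ f x

/-- `∂_{xₙ} G_t`, the partial derivative of the Gauss kernel in the last coordinate. -/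
def gaussDn (m : ℕ) (t : ℝ) (z : HalfSpacePt m) : ℝ :=
  deriv (fun w => gauss m t (z.1, w)) z.2

/-- The `i`-th standard coordinate vector of `ℝⁿ`, `n = m + 1` (the case `i = n`
being the inward normal direction `eₙ`). -/
def coordVec (m : ℕ) (i : Fin (m + 1)) : HalfSpacePt m :=
  if h : (i : ℕ) < m then (Pi.single ⟨i, h⟩ 1, 0) else (0, 1)

/-- Young's inequality `L¹ * L^q ⊆ L^q` for nonnegative functions. -/
theorem eLpNorm_lintegral_sub_mul_le {G : Type*} [AddCommGroup G] [MeasurableSpace G]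
    [MeasurableAdd₂ G] [MeasurableNeg G] {μ : Measure G} [SFinite μ] [μ.IsAddLeftInvariant]
    [μ.IsNegInvariant] {L φ : G → ℝ≥0∞} (hL : Measurable L) (hφ : Measurable φ)
    {q : ℝ≥0∞} (hq : 1 ≤ q) :
    eLpNorm (fun x => ∫⁻ y, L (x - y) * φ y ∂μ) q μ ≤ (∫⁻ z, L z ∂μ) * eLpNorm φ q μ := by
  set ν := μ.withDensity L with hν
  have hW : ν Set.univ = ∫⁻ z, L z ∂μ := by simp [hν, withDensity_apply]
  have hT : ∀ x, ∫⁻ y, L (x - y) * φ y ∂μ = ∫⁻ z, φ (x - z) ∂ν := by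
    intro x
    rw [hν, lintegral_withDensity_eq_lintegral_mul _ hL (by fun_prop),
      ← lintegral_sub_left_eq_self _ x]
    simp
  simp_rw [hT, ← hW]
  have hq0 : q ≠ 0 := (zero_lt_one.trans_le hq).ne'
  rcases eq_or_ne q ∞ with rfl | hqt
  · simp only [eLpNorm_exponent_top]
    refine essSup_le_of_ae_le _ (Filter.Eventually.of_forall fun x => ?_)
    have hae : ∀ᵐ z ∂ν, φ (x - z) ≤ eLpNormEssSup φ μ := by
      refine (withDensity_absolutelyContinuous μ L).ae_le ?_
      have := ae_le_eLpNormEssSup (f := φ) (μ := μ)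
      simp only [enorm_eq_self] at this
      exact (quasiMeasurePreserving_sub_left μ x).ae this
    calc ‖∫⁻ z, φ (x - z) ∂ν‖ₑ ≤ ∫⁻ z, eLpNormEssSup φ μ ∂ν := lintegral_mono_ae hae
      _ = _ := by rw [lintegral_const, mul_comm]
  · have hp : 0 < q.toReal := ENNReal.toReal_pos hq0 hqt
    have hp1 : 1 ≤ q.toReal := by
      rwa [← ENNReal.toReal_one, ENNReal.toReal_le_toReal one_ne_top hqt]
    have hJ : ∀ x, (∫⁻ z, φ (x - z) ∂ν) ^ q.toReal ≤
        (ν Set.univ) ^ (q.toReal - 1) * ∫⁻ z, φ (x - z) ^ q.toReal ∂ν := by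
      intro x
      have h := eLpNorm'_le_eLpNorm'_mul_rpow_measure_univ (μ := ν) (f := fun z => φ (x - z))
        zero_lt_one hp1 (by fun_prop : Measurable fun z => φ (x - z)).aestronglyMeasurable
      simp only [eLpNorm', enorm_eq_self, ENNReal.rpow_one, div_one] at h
      calc _ ≤ _ := ENNReal.rpow_le_rpow h hp.le
        _ = _ := by
          rw [ENNReal.mul_rpow_of_nonneg _ _ hp.le, ← ENNReal.rpow_mul, ← ENNReal.rpow_mul,
            one_div_mul_cancel hp.ne', ENNReal.rpow_one, mul_comm, sub_mul,
            one_div_mul_cancel hp.ne', one_mul]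
    rw [eLpNorm_eq_lintegral_rpow_enorm_toReal hq0 hqt,
      eLpNorm_eq_lintegral_rpow_enorm_toReal hq0 hqt]
    simp only [enorm_eq_self]
    have hI : ∫⁻ x, (∫⁻ z, φ (x - z) ∂ν) ^ q.toReal ∂μ ≤
        ν Set.univ ^ q.toReal * ∫⁻ x, φ x ^ q.toReal ∂μ := by
      calc _ ≤ ∫⁻ x, (ν Set.univ) ^ (q.toReal - 1) * ∫⁻ z, φ (x - z) ^ q.toReal ∂ν ∂μ :=
            lintegral_mono hJ
        _ = (ν Set.univ) ^ (q.toReal - 1) * ∫⁻ z, ∫⁻ x, φ (x - z) ^ q.toReal ∂μ ∂ν := by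
            rw [lintegral_const_mul'' _ (by
              refine (Measurable.lintegral_prod_right' (f := fun p : G × G =>
                φ (p.1 - p.2) ^ q.toReal) (by fun_prop)).aemeasurable),
              lintegral_lintegral_swap (by fun_prop)]
        _ = (ν Set.univ) ^ (q.toReal - 1) * ((∫⁻ x, φ x ^ q.toReal ∂μ) * ν Set.univ) := by
            simp_rw [fun z => lintegral_sub_right_eq_self (μ := μ) (fun x => φ x ^ q.toReal) z]
            rw [lintegral_const]
        _ = _ := by
            rw [mul_comm (∫⁻ x, φ x ^ q.toReal ∂μ), ← mul_assoc]
            congr 1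
            nth_rw 2 [← ENNReal.rpow_one (ν Set.univ)]
            rw [← ENNReal.rpow_add_of_nonneg _ _ (by linarith) zero_le_one, sub_add_cancel]
    calc _ ≤ _ := ENNReal.rpow_le_rpow hI (by positivity)
      _ = _ := by
        rw [ENNReal.mul_rpow_of_nonneg _ _ (by positivity), ← ENNReal.rpow_mul,
          mul_one_div_cancel hp.ne', ENNReal.rpow_one]

theorem abs_le_mul_exp_sq_div (v : ℝ) : |v| ≤ 2 * Real.exp (v ^ 2 / 8) := by
  have h := Real.add_one_le_exp (v ^ 2 / 8)
  have := sq_abs v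
  nlinarith [sq_nonneg (|v| - 2)]

theorem abs_le_mul_sqrt_mul_exp {t : ℝ} (ht : 0 < t) (w : ℝ) :
    |w| ≤ 2 * √t * Real.exp (w ^ 2 / (8 * t)) := by
  have hs : 0 < √t := Real.sqrt_pos.2 ht
  have h := abs_le_mul_exp_sq_div (w / √t)
  rw [abs_div, abs_of_pos hs, div_le_iff₀ hs, div_pow, Real.sq_sqrt ht.le, div_div,
    mul_comm t 8] at h
  linarith

/-- Mean value bound for a function whose derivative is dominated by a Gaussian. -/
theorem abs_sub_le_of_deriv_le_gaussian {h h' : ℝ → ℝ} {C : ℝ} (hC : 0 ≤ C)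
    (hd : ∀ v, HasDerivAt h (h' v) v) (hb : ∀ v, |h' v| ≤ C * Real.exp (-v ^ 2 / 8))
    {p r : ℝ} (hp : 0 ≤ p) (hpr : p ≤ r) :
    |h p - h r| ≤ C * Real.exp (-p ^ 2 / 8) * (r - p) := by
  have := (convex_Ici p).norm_image_sub_le_of_norm_hasDerivWithin_le (f := h) (f' := h')
    (C := C * Real.exp (-p ^ 2 / 8)) (x := r) (y := p)
    (fun v _ => (hd v).hasDerivWithinAt) (fun v hv => by
      refine (hb v).trans ?_
      have : p ≤ v := hv
      gcongr) hpr Set.self_mem_Ici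
  rwa [Real.norm_eq_abs, Real.norm_eq_abs, abs_sub_comm p r,
    abs_of_nonneg (sub_nonneg.2 hpr)] at this

theorem abs_mul_exp_neg_le {v P C : ℝ} (h : |P| ≤ C * Real.exp (v ^ 2 / 8)) :
    |P * Real.exp (-v ^ 2 / 4)| ≤ C * Real.exp (-v ^ 2 / 8) := by
  rw [abs_mul, Real.abs_exp]
  calc _ ≤ C * Real.exp (v ^ 2 / 8) * Real.exp (-v ^ 2 / 4) := by gcongr
    _ = _ := by rw [mul_assoc, ← Real.exp_add]; congr 2; ring

theorem hasDerivAt_exp_neg_sq_div_four (v : ℝ) :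
    HasDerivAt (fun v : ℝ => Real.exp (-v ^ 2 / 4)) (Real.exp (-v ^ 2 / 4) * (-v / 2)) v := by
  have := (((hasDerivAt_id v).pow 2).neg.div_const 4).exp
  convert! this using 1
  simp; ring

theorem abs_hermite_one_sub_le {X Y : ℝ} (hX : 0 < X) (hY : 0 < Y) :
    |(X - Y) * Real.exp (-(X - Y) ^ 2 / 4) - (X + Y) * Real.exp (-(X + Y) ^ 2 / 4)| ≤
      8 * Y * Real.exp (-(X - Y) ^ 2 / 8) := by
  rcases le_or_gt Y X with hYX | hXY
  · have := abs_sub_le_of_deriv_le_gaussian (h := fun v => v * Real.exp (-v ^ 2 / 4))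
      (h' := fun v => (1 - v ^ 2 / 2) * Real.exp (-v ^ 2 / 4)) (C := 4) (by norm_num)
      (fun v => by
        convert! (hasDerivAt_id v).mul (hasDerivAt_exp_neg_sq_div_four v) using 1
        simp; ring)
      (fun v => abs_mul_exp_neg_le (by
        have h := Real.add_one_le_exp (v ^ 2 / 8)
        rw [abs_le]; constructor <;> nlinarith [sq_nonneg v]))
      (sub_nonneg.2 hYX) (show X - Y ≤ X + Y by linarith)
    refine this.trans (le_of_eq (by ring))
  · have h1 : Real.exp (-(X - Y) ^ 2 / 4) ≤ Real.exp (-(X - Y) ^ 2 / 8) :=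
      Real.exp_le_exp.2 (by nlinarith [sq_nonneg (X - Y)])
    have h2 : Real.exp (-(X + Y) ^ 2 / 4) ≤ Real.exp (-(X - Y) ^ 2 / 8) :=
      Real.exp_le_exp.2 (by nlinarith [sq_nonneg (X - Y), mul_pos hX hY])
    have h3 : (Y - X) * Real.exp (-(X - Y) ^ 2 / 4) ≤ Y * Real.exp (-(X - Y) ^ 2 / 8) := by
      gcongr; linarith
    have h4 : (X + Y) * Real.exp (-(X + Y) ^ 2 / 4) ≤ (2 * Y) * Real.exp (-(X - Y) ^ 2 / 8) := by
      gcongr; linarith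
    have h5 : 0 ≤ (Y - X) * Real.exp (-(X - Y) ^ 2 / 4) :=
      mul_nonneg (by linarith) (Real.exp_pos _).le
    have h6 : 0 ≤ (X + Y) * Real.exp (-(X + Y) ^ 2 / 4) := by positivity
    have h7 := mul_pos hY (Real.exp_pos (-(X - Y) ^ 2 / 8))
    rw [abs_le]; constructor <;> linarith

theorem abs_hermite_two_sub_le {X Y : ℝ} (hX : 0 < X) (hY : 0 < Y) :
    |((X - Y) ^ 2 / 4 - 1 / 2) * Real.exp (-(X - Y) ^ 2 / 4) -
      ((X + Y) ^ 2 / 4 - 1 / 2) * Real.exp (-(X + Y) ^ 2 / 4)| ≤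
      16 * Y * Real.exp (-(X - Y) ^ 2 / 8) := by
  have := abs_sub_le_of_deriv_le_gaussian
      (h := fun v => (v ^ 2 / 4 - 1 / 2) * Real.exp (-v ^ 2 / 4))
      (h' := fun v => (3 / 4 * v - v ^ 3 / 8) * Real.exp (-v ^ 2 / 4)) (C := 8) (by norm_num)
      (fun v => by
        convert! ((((hasDerivAt_id v).pow 2).div_const 4).sub_const (1 / 2)).mul
          (hasDerivAt_exp_neg_sq_div_four v) using 1
        simp; ring)
      (fun v => abs_mul_exp_neg_le (by
        have h := Real.add_one_le_exp (v ^ 2 / 16)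
        have h1 : Real.exp (v ^ 2 / 8) = Real.exp (v ^ 2 / 16) ^ 2 := by
          rw [← Real.exp_nat_mul]; congr 1; push_cast; ring
        have hv : |v| ≤ 2 * (v ^ 2 / 16 + 1) := by
          nlinarith [sq_nonneg (|v| - 4), sq_abs v]
        have h2 : |3 / 4 * v - v ^ 3 / 8| ≤ |v| * (3 / 4 + v ^ 2 / 8) := by
          rw [show 3 / 4 * v - v ^ 3 / 8 = v * (3 / 4 - v ^ 2 / 8) by ring, abs_mul]
          gcongr
          rw [abs_le]; constructor <;> nlinarith [sq_nonneg v]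
        calc _ ≤ _ := h2
          _ ≤ 2 * (v ^ 2 / 16 + 1) * (2 * (v ^ 2 / 16 + 1)) := by
            gcongr; nlinarith [sq_nonneg v]
          _ = 4 * (v ^ 2 / 16 + 1) ^ 2 := by ring
          _ ≤ 8 * Real.exp (v ^ 2 / 16) ^ 2 := by gcongr; norm_num
          _ = _ := by rw [h1]))
      (abs_nonneg (X - Y)) (show |X - Y| ≤ X + Y by rw [abs_le]; constructor <;> linarith)
  simp only [sq_abs] at this
  refine this.trans ?_
  have h1 : X + Y - |X - Y| ≤ 2 * Y := by linarith [le_abs_self (X - Y)]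
  calc _ ≤ 8 * Real.exp (-(X - Y) ^ 2 / 8) * (2 * Y) := by gcongr
    _ = _ := by ring

/-- The `k`-th coordinate of a point. -/
def coordAt (m : ℕ) (k : Fin (m + 1)) (z : HalfSpacePt m) : ℝ :=
  if h : (k : ℕ) < m then z.1 ⟨k, h⟩ else z.2

/-- The partial derivative `∂_k G_t`. -/
def gaussD (m : ℕ) (k : Fin (m + 1)) (t : ℝ) (z : HalfSpacePt m) : ℝ :=
  -(coordAt m k z / (2 * t)) * gauss m t z

/-- The second partial derivative `∂ₙ ∂_k G_t`. -/
def gaussDD (m : ℕ) (k : Fin (m + 1)) (t : ℝ) (z : HalfSpacePt m) : ℝ :=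
  (coordAt m k z / (2 * t) * (z.2 / (2 * t)) - if (k : ℕ) < m then 0 else 1 / (2 * t)) *
    gauss m t z

/-- The constant comparing `G_t` with `G_{2t}`. -/
def doublingConst (m : ℕ) : ℝ := (2 : ℝ) ^ (((m : ℝ) + 1) / 2)

theorem doublingConst_pos (m : ℕ) : 0 < doublingConst m := by
  unfold doublingConst; positivity

theorem gauss_nonneg (m : ℕ) {t : ℝ} (ht : 0 < t) (z : HalfSpacePt m) : 0 ≤ gauss m t z := by
  unfold gauss; positivity

theorem gauss_eq_doubling (m : ℕ) {t : ℝ} (ht : 0 < t) (z : HalfSpacePt m) :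
    gauss m t z = doublingConst m * Real.exp (-(∑ i, z.1 i ^ 2) / (8 * t)) *
      Real.exp (-z.2 ^ 2 / (8 * t)) * gauss m (2 * t) z := by
  have h1 : (4 * Real.pi * t) ^ (-((m : ℝ) + 1) / 2) =
      doublingConst m * (4 * Real.pi * (2 * t)) ^ (-((m : ℝ) + 1) / 2) := by
    rw [show 4 * Real.pi * (2 * t) = 2 * (4 * Real.pi * t) by ring,
      Real.mul_rpow (x := 2) (by norm_num) (by positivity), ← mul_assoc, doublingConst,
      ← Real.rpow_add (by norm_num), show ((m : ℝ) + 1) / 2 + -((m : ℝ) + 1) / 2 = 0 by ring,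
      Real.rpow_zero, one_mul]
  unfold gauss
  rw [h1]
  have h2 : Real.exp (-((∑ i, z.1 i ^ 2) + z.2 ^ 2) / (4 * t)) =
      Real.exp (-(∑ i, z.1 i ^ 2) / (8 * t)) * Real.exp (-z.2 ^ 2 / (8 * t)) *
        Real.exp (-((∑ i, z.1 i ^ 2) + z.2 ^ 2) / (4 * (2 * t))) := by
    rw [← Real.exp_add, ← Real.exp_add]; congr 1; field_simp; ring
  rw [h2]; ring

theorem continuous_gauss (m : ℕ) (t : ℝ) : Continuous (gauss m t) := by
  unfold gauss; fun_prop

theorem measurable_gauss (m : ℕ) : Measurable fun p : ℝ × HalfSpacePt m => gauss m p.1 p.2 := by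
  unfold gauss; fun_prop

theorem continuous_coordAt (m : ℕ) (k : Fin (m + 1)) : Continuous (coordAt m k) := by
  unfold coordAt; split_ifs <;> fun_prop

theorem continuous_gaussD (m : ℕ) (k : Fin (m + 1)) (t : ℝ) : Continuous (gaussD m k t) := by
  have := continuous_gauss m t
  have := continuous_coordAt m k
  unfold gaussD; fun_prop

theorem continuous_gaussDD (m : ℕ) (k : Fin (m + 1)) (t : ℝ) : Continuous (gaussDD m k t) := by
  have := continuous_gauss m t
  have := continuous_coordAt m k
  unfold gaussDD; fun_prop

theorem measurable_gaussD (m : ℕ) (k : Fin (m + 1)) :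
    Measurable fun p : ℝ × HalfSpacePt m => gaussD m k p.1 p.2 := by
  have := measurable_gauss m
  have := (continuous_coordAt m k).measurable
  unfold gaussD; fun_prop

theorem lintegral_gauss (m : ℕ) {t : ℝ} (ht : 0 < t) :
    ∫⁻ z, ENNReal.ofReal (gauss m t z) = 1 := by
  have hb : 0 < 1 / (4 * t) := by positivity
  have hI : ∀ z : HalfSpacePt m, gauss m t z = (4 * Real.pi * t) ^ (-((m : ℝ) + 1) / 2) *
      ((∏ i, Real.exp (-(1 / (4 * t)) * z.1 i ^ 2)) * Real.exp (-(1 / (4 * t)) * z.2 ^ 2)) := by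
    intro z
    rw [← Real.exp_sum, ← Real.exp_add, ← Finset.mul_sum, gauss]
    congr 2; ring
  have hint : Integrable (gauss m t) := by
    rw [show gauss m t = _ from funext hI]
    refine Integrable.const_mul ?_ _
    refine Integrable.mul_prod (f := fun z : Fin m → ℝ => ∏ i, Real.exp (-(1 / (4 * t)) * z i ^ 2))
      (g := fun w : ℝ => Real.exp (-(1 / (4 * t)) * w ^ 2)) ?_ (integrable_exp_neg_mul_sq hb)
    exact Integrable.fintype_prod (f := fun _ w => Real.exp (-(1 / (4 * t)) * w ^ 2))
      fun _ => integrable_exp_neg_mul_sq hb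
  rw [← ofReal_integral_eq_lintegral_ofReal hint (.of_forall (gauss_nonneg m ht))]
  have : ∫ z, gauss m t z = 1 := by
    simp_rw [hI]
    rw [integral_const_mul, Measure.volume_eq_prod, integral_prod_mul
      (f := fun z : Fin m → ℝ => ∏ i, Real.exp (-(1 / (4 * t)) * z i ^ 2))
      (g := fun w : ℝ => Real.exp (-(1 / (4 * t)) * w ^ 2)),
      integral_fintype_prod_volume_eq_pow (fun w : ℝ => Real.exp (-(1 / (4 * t)) * w ^ 2)),
      integral_gaussian, Fintype.card_fin, ← pow_succ,
      show Real.pi / (1 / (4 * t)) = 4 * Real.pi * t by field_simp, Real.sqrt_eq_rpow,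
      ← Real.rpow_mul_natCast (by positivity), ← Real.rpow_add (by positivity)]
    rw [show -((m : ℝ) + 1) / 2 + 1 / 2 * ((m + 1 : ℕ) : ℝ) = 0 by push_cast; ring, Real.rpow_zero]
  rw [this, ENNReal.ofReal_one]

theorem abs_coordAt_mul_exp_le (m : ℕ) (k : Fin (m + 1)) {t : ℝ} (ht : 0 < t)
    (z : HalfSpacePt m) :
    |coordAt m k z| * Real.exp (-(∑ i, z.1 i ^ 2) / (8 * t)) * Real.exp (-z.2 ^ 2 / (8 * t)) ≤
      2 * √t := by
  rw [mul_assoc, ← Real.exp_add]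
  have h := abs_le_mul_sqrt_mul_exp ht (coordAt m k z)
  have h2 : coordAt m k z ^ 2 ≤ ∑ i, z.1 i ^ 2 + z.2 ^ 2 := by
    unfold coordAt; split_ifs with hk
    · have := Finset.single_le_sum (f := fun i => z.1 i ^ 2) (fun i _ => sq_nonneg _)
        (Finset.mem_univ (⟨k, hk⟩ : Fin m))
      nlinarith [sq_nonneg z.2]
    · have := Finset.sum_nonneg (s := Finset.univ) fun i _ => sq_nonneg (z.1 i)
      linarith
  calc _ ≤ 2 * √t * Real.exp (coordAt m k z ^ 2 / (8 * t)) *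
        Real.exp (-(∑ i, z.1 i ^ 2) / (8 * t) + -z.2 ^ 2 / (8 * t)) := by gcongr
    _ ≤ 2 * √t * 1 := by
      rw [mul_assoc, ← Real.exp_add]
      gcongr
      rw [Real.exp_le_one_iff, ← add_div, ← add_div]
      exact div_nonpos_of_nonpos_of_nonneg (by linarith) (by positivity)
    _ = _ := mul_one _

theorem abs_gaussD_le (m : ℕ) (k : Fin (m + 1)) {t : ℝ} (ht : 0 < t) (z : HalfSpacePt m) :
    |gaussD m k t z| ≤ doublingConst m * (√t)⁻¹ * gauss m (2 * t) z := by
  have hg := gauss_nonneg m (show 0 < 2 * t by positivity) z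
  have hd := doublingConst_pos m
  have hs : 0 < √t := Real.sqrt_pos.2 ht
  rw [gaussD, abs_mul, abs_neg, abs_div, abs_of_pos (show 0 < 2 * t by positivity),
    abs_of_nonneg (gauss_nonneg m ht z), gauss_eq_doubling m ht z]
  calc _ = doublingConst m / (2 * t) * (|coordAt m k z| *
        Real.exp (-(∑ i, z.1 i ^ 2) / (8 * t)) * Real.exp (-z.2 ^ 2 / (8 * t))) *
          gauss m (2 * t) z := by ring
    _ ≤ doublingConst m / (2 * t) * (2 * √t) * gauss m (2 * t) z := by
      have := abs_coordAt_mul_exp_le m k ht z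
      gcongr
    _ = _ := by
      congr 1
      rw [mul_comm, ← mul_div_assoc, mul_comm (_ : ℝ) (√t)⁻¹, ← div_eq_inv_mul]
      rw [div_eq_div_iff (by positivity) hs.ne']
      nlinarith [Real.mul_self_sqrt ht.le]

theorem gauss_reflect_le (m : ℕ) {t : ℝ} (ht : 0 < t) {x y : HalfSpacePt m} (hx : 0 < x.2)
    (hy : 0 < y.2) :
    gauss m t (x.1 - y.1, x.2 + y.2) ≤ gauss m t (x.1 - y.1, x.2 - y.2) := by
  unfold gauss
  have : (x.2 - y.2) ^ 2 ≤ (x.2 + y.2) ^ 2 := by nlinarith [mul_pos hx hy]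
  simp only
  gcongr

theorem hermite_one_scaled {t : ℝ} (ht : 0 < t) {x y : ℝ} (hx : 0 < x) (hy : 0 < y) :
    |(x - y) * Real.exp (-(x - y) ^ 2 / (4 * t)) - (x + y) * Real.exp (-(x + y) ^ 2 / (4 * t))| ≤
      8 * y * Real.exp (-(x - y) ^ 2 / (8 * t)) := by
  have hs : 0 < √t := Real.sqrt_pos.2 ht
  have h := mul_le_mul_of_nonneg_left (abs_hermite_one_sub_le (div_pos hx hs) (div_pos hy hs)) hs.le
  rw [← abs_of_pos hs, ← abs_mul, abs_of_pos hs] at h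
  simp only [← sub_div, ← add_div, div_pow, Real.sq_sqrt ht.le, ← neg_div, div_div] at h
  rw [mul_comm t 4, mul_comm t 8] at h
  convert! h using 1
  · congr 1; field_simp
  · field_simp

theorem hermite_two_scaled {t : ℝ} (ht : 0 < t) {x y : ℝ} (hx : 0 < x) (hy : 0 < y) :
    |((x - y) ^ 2 / (4 * t) - 1 / 2) * Real.exp (-(x - y) ^ 2 / (4 * t)) -
      ((x + y) ^ 2 / (4 * t) - 1 / 2) * Real.exp (-(x + y) ^ 2 / (4 * t))| ≤
      16 * (y / √t) * Real.exp (-(x - y) ^ 2 / (8 * t)) := by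
  have hs : 0 < √t := Real.sqrt_pos.2 ht
  have h := abs_hermite_two_sub_le (div_pos hx hs) (div_pos hy hs)
  simp only [← sub_div, ← add_div, div_pow, Real.sq_sqrt ht.le, ← neg_div, div_div] at h
  rwa [mul_comm t 4, mul_comm t 8] at h

theorem gauss_eq_mul_exp (m : ℕ) (t : ℝ) (z : Fin m → ℝ) (w : ℝ) :
    gauss m (2 * t) (z, w) = gauss m (2 * t) (z, 0) * Real.exp (-w ^ 2 / (8 * t)) := by
  unfold gauss
  rw [mul_assoc ((4 * Real.pi * (2 * t)) ^ (-((m : ℝ) + 1) / 2)), ← Real.exp_add]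
  congr 2
  simp only
  rw [show 4 * (2 * t) = 8 * t by ring, ← add_div]
  congr 1; ring

theorem gauss_eq_doubling_mul_exp (m : ℕ) {t : ℝ} (ht : 0 < t) (z : Fin m → ℝ) (w : ℝ) :
    gauss m t (z, w) = doublingConst m * Real.exp (-(∑ i, z i ^ 2) / (8 * t)) *
      gauss m (2 * t) (z, 0) * Real.exp (-w ^ 2 / (4 * t)) := by
  rw [gauss_eq_doubling m ht, gauss_eq_mul_exp,
    show -w ^ 2 / (4 * t) = -w ^ 2 / (8 * t) + -w ^ 2 / (8 * t) by field_simp; ring, Real.exp_add]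
  ring

theorem coordAt_last (m : ℕ) (z : HalfSpacePt m) : coordAt m (Fin.last m) z = z.2 := by
  simp [coordAt]

theorem abs_gaussD_last_sub_le (m : ℕ) {t : ℝ} (ht : 0 < t) (z : Fin m → ℝ) {x y : ℝ}
    (hx : 0 < x) (hy : 0 < y) :
    |gaussD m (Fin.last m) t (z, x - y) - gaussD m (Fin.last m) t (z, x + y)| ≤
      4 * doublingConst m * t⁻¹ * y * Real.exp (-(∑ i, z i ^ 2) / (8 * t)) *
        gauss m (2 * t) (z, x - y) := by
  have hg := gauss_nonneg m (show 0 < 2 * t by positivity) (z, (0 : ℝ))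
  have hd := doublingConst_pos m
  simp only [gaussD, coordAt_last]
  rw [gauss_eq_doubling_mul_exp m ht z (x - y), gauss_eq_doubling_mul_exp m ht z (x + y),
    gauss_eq_mul_exp m t z (x - y)]
  set q := Real.exp (-(∑ i, z i ^ 2) / (8 * t)) with hq
  have hq0 : 0 < q := Real.exp_pos _
  set B := gauss m (2 * t) (z, (0 : ℝ))
  have h := hermite_one_scaled ht hx hy
  set E1 := Real.exp (-(x - y) ^ 2 / (4 * t))
  set E2 := Real.exp (-(x + y) ^ 2 / (4 * t))
  have e : -((x - y) / (2 * t)) * (doublingConst m * q * B * E1) -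
      -((x + y) / (2 * t)) * (doublingConst m * q * B * E2) =
      -(doublingConst m * q * B / (2 * t) * ((x - y) * E1 - (x + y) * E2)) := by ring
  rw [e, abs_neg, abs_mul, abs_of_nonneg (show 0 ≤ doublingConst m * q * B / (2 * t) by positivity)]
  calc _ ≤ doublingConst m * q * B / (2 * t) * (8 * y * Real.exp (-(x - y) ^ 2 / (8 * t))) := by
        gcongr
    _ = _ := by ring

theorem exp_neg_sum_sq_le_one {m : ℕ} {t : ℝ} (ht : 0 < t) (z : Fin m → ℝ) :
    Real.exp (-(∑ i, z i ^ 2) / (8 * t)) ≤ 1 := by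
  rw [Real.exp_le_one_iff]
  exact div_nonpos_of_nonpos_of_nonneg
    (neg_nonpos.2 (Finset.sum_nonneg fun i _ => sq_nonneg _)) (by positivity)

theorem abs_gaussD_last_sub_le' (m : ℕ) {t : ℝ} (ht : 0 < t) (z : Fin m → ℝ) {x y : ℝ}
    (hx : 0 < x) (hy : 0 < y) :
    |gaussD m (Fin.last m) t (z, x - y) - gaussD m (Fin.last m) t (z, x + y)| ≤
      4 * doublingConst m * t⁻¹ * y * gauss m (2 * t) (z, x - y) := by
  refine (abs_gaussD_last_sub_le m ht z hx hy).trans ?_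
  have hg := gauss_nonneg m (show 0 < 2 * t by positivity) (z, x - y)
  have hd := doublingConst_pos m
  refine mul_le_mul_of_nonneg_right (mul_le_of_le_one_right (by positivity) ?_) hg
  exact exp_neg_sum_sq_le_one ht z

theorem abs_gaussDD_sub_le (m : ℕ) (k : Fin (m + 1)) {t : ℝ} (ht : 0 < t) (z : Fin m → ℝ)
    {x y : ℝ} (hx : 0 < x) (hy : 0 < y) :
    |gaussDD m k t (z, x - y) - gaussDD m k t (z, x + y)| ≤
      16 * doublingConst m * (t * √t)⁻¹ * y * gauss m (2 * t) (z, x - y) := by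
  have hG := gauss_nonneg m (show 0 < 2 * t by positivity) (z, x - y)
  have hd := doublingConst_pos m
  have hs : 0 < √t := Real.sqrt_pos.2 ht
  by_cases hk : (k : ℕ) < m
  · have e : ∀ w : ℝ, gaussDD m k t (z, w) =
        -(z ⟨k, hk⟩ / (2 * t)) * gaussD m (Fin.last m) t (z, w) := by
      intro w
      have hz : coordAt m k (z, w) = z ⟨k, hk⟩ := by simp [coordAt, hk]
      simp only [gaussDD, gaussD, coordAt_last, hk, if_true, hz]
      ring
    have h := abs_gaussD_last_sub_le m ht z hx hy
    have hc := abs_coordAt_mul_exp_le m k ht (z, (0 : ℝ))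
    simp only [coordAt, hk, dif_pos] at hc
    rw [show -(0 : ℝ) ^ 2 / (8 * t) = 0 by simp, Real.exp_zero, mul_one] at hc
    rw [e, e, ← mul_sub, abs_mul, abs_neg, abs_div, abs_of_pos (show 0 < 2 * t by positivity)]
    calc _ ≤ |z ⟨k, hk⟩| / (2 * t) * (4 * doublingConst m * t⁻¹ * y *
          Real.exp (-(∑ i, z i ^ 2) / (8 * t)) * gauss m (2 * t) (z, x - y)) := by gcongr
      _ = (|z ⟨k, hk⟩| * Real.exp (-(∑ i, z i ^ 2) / (8 * t))) *
          (2 * doublingConst m * t⁻¹ * t⁻¹ * y * gauss m (2 * t) (z, x - y)) := by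
        field_simp; ring
      _ ≤ 2 * √t * (2 * doublingConst m * t⁻¹ * t⁻¹ * y * gauss m (2 * t) (z, x - y)) := by
        gcongr
      _ = 4 * doublingConst m * (t * √t)⁻¹ * y * gauss m (2 * t) (z, x - y) := by
        have : √t * t⁻¹ = (√t)⁻¹ := by
          rw [← div_eq_mul_inv, Real.sqrt_div_self]
        rw [mul_inv, ← this]; ring
      _ ≤ _ := by gcongr; norm_num
  · have hg := gauss_nonneg m (show 0 < 2 * t by positivity) (z, (0 : ℝ))
    simp only [gaussDD, coordAt, hk, dite_false, if_false]
    rw [gauss_eq_doubling_mul_exp m ht z (x - y), gauss_eq_doubling_mul_exp m ht z (x + y),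
      gauss_eq_mul_exp m t z (x - y)]
    have hq1 := exp_neg_sum_sq_le_one ht z
    set q := Real.exp (-(∑ i, z i ^ 2) / (8 * t)) with hq
    have hq0 : 0 < q := Real.exp_pos _
    set B := gauss m (2 * t) (z, (0 : ℝ))
    have h := hermite_two_scaled ht hx hy
    set E1 := Real.exp (-(x - y) ^ 2 / (4 * t))
    set E2 := Real.exp (-(x + y) ^ 2 / (4 * t))
    have e : ((x - y) / (2 * t) * ((x - y) / (2 * t)) - 1 / (2 * t)) *
          (doublingConst m * q * B * E1) -
        ((x + y) / (2 * t) * ((x + y) / (2 * t)) - 1 / (2 * t)) *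
          (doublingConst m * q * B * E2) =
        doublingConst m * q * B / t * (((x - y) ^ 2 / (4 * t) - 1 / 2) * E1 -
          ((x + y) ^ 2 / (4 * t) - 1 / 2) * E2) := by field_simp; ring
    rw [e, abs_mul, abs_of_nonneg (show 0 ≤ doublingConst m * q * B / t by positivity)]
    calc _ ≤ doublingConst m * 1 * B / t *
          (16 * (y / √t) * Real.exp (-(x - y) ^ 2 / (8 * t))) := by gcongr
      _ = _ := by field_simp

instance isAddHaarMeasure_volume_halfSpacePt (m : ℕ) :
    (volume : Measure (HalfSpacePt m)).IsAddHaarMeasure :=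
  inferInstanceAs (((volume : Measure (Fin m → ℝ)).prod (volume : Measure ℝ)).IsAddHaarMeasure)

theorem coordVec_last (m : ℕ) : coordVec m (Fin.last m) = (0, 1) := by
  simp [coordVec]

theorem coordAt_add_smul (m : ℕ) (k : Fin (m + 1)) (z : HalfSpacePt m) (s : ℝ) :
    coordAt m k (z + s • coordVec m k) = coordAt m k z + s := by
  unfold coordAt coordVec
  split_ifs with h <;> simp

theorem sum_sq_add_smul (m : ℕ) (k : Fin (m + 1)) (z : HalfSpacePt m) (s : ℝ) :
    (∑ i, (z + s • coordVec m k).1 i ^ 2) + (z + s • coordVec m k).2 ^ 2 =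
      (∑ i, z.1 i ^ 2) + z.2 ^ 2 + 2 * s * coordAt m k z + s ^ 2 := by
  unfold coordAt coordVec
  split_ifs with h
  · simp only [Prod.smul_mk, Prod.fst_add, Prod.snd_add, Pi.add_apply,
      Pi.smul_apply, smul_eq_mul, add_sq, Finset.sum_add_distrib]
    have h1 : ∑ i, 2 * z.1 i * (s * (Pi.single (⟨k, h⟩ : Fin m) (1 : ℝ) : Fin m → ℝ) i) =
        2 * s * z.1 ⟨k, h⟩ := by
      rw [Finset.sum_eq_single (⟨k, h⟩ : Fin m)]
      · simp; ring
      · intro b _ hb; simp [hb]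
      · simp
    have h2 : ∑ i, (s * (Pi.single (⟨k, h⟩ : Fin m) (1 : ℝ) : Fin m → ℝ) i) ^ 2 = s ^ 2 := by
      rw [Finset.sum_eq_single (⟨k, h⟩ : Fin m)]
      · simp
      · intro b _ hb; simp [hb]
      · simp
    rw [h1, h2]; ring
  · simp; ring

theorem hasDerivAt_gauss_line (m : ℕ) (k : Fin (m + 1)) {t : ℝ} (ht : 0 < t)
    (z : HalfSpacePt m) (s : ℝ) :
    HasDerivAt (fun s : ℝ => gauss m t (z + s • coordVec m k))
      (gaussD m k t (z + s • coordVec m k)) s := by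
  have hp : HasDerivAt (fun s : ℝ => -((∑ i, z.1 i ^ 2) + z.2 ^ 2 + 2 * s * coordAt m k z + s ^ 2)
      / (4 * t)) (-(coordAt m k z + s) / (2 * t)) s := by
    have h := (((((hasDerivAt_id s).const_mul 2).mul_const (coordAt m k z)).const_add
      ((∑ i, z.1 i ^ 2) + z.2 ^ 2)).add ((hasDerivAt_id s).pow 2)).neg.div_const (4 * t)
    convert! h using 1
    simp; field_simp; ring
  have := hp.exp.const_mul ((4 * Real.pi * t) ^ (-((m : ℝ) + 1) / 2))
  simp only [← sum_sq_add_smul] at this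
  convert! this using 1
  rw [gaussD, coordAt_add_smul, gauss]
  ring

theorem hasDerivAt_coordAt_vertical (m : ℕ) (k : Fin (m + 1)) (z : HalfSpacePt m) (s : ℝ) :
    HasDerivAt (fun s : ℝ => coordAt m k (z + s • coordVec m (Fin.last m)))
      (if (k : ℕ) < m then 0 else 1) s := by
  rw [coordVec_last]
  unfold coordAt
  split_ifs with h
  · simpa using hasDerivAt_const s _
  · simpa using (hasDerivAt_id s).const_add z.2

theorem hasDerivAt_gaussD_line (m : ℕ) (k : Fin (m + 1)) {t : ℝ} (ht : 0 < t)
    (z : HalfSpacePt m) (s : ℝ) :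
    HasDerivAt (fun s : ℝ => gaussD m k t (z + s • coordVec m (Fin.last m)))
      (gaussDD m k t (z + s • coordVec m (Fin.last m))) s := by
  have h := ((hasDerivAt_coordAt_vertical m k z s).div_const (2 * t)).neg.mul
    (hasDerivAt_gauss_line m (Fin.last m) ht z s)
  convert! h using 1
  rw [gaussDD, gaussD, coordAt_last]
  simp only [Pi.neg_apply]
  split_ifs <;> field_simp <;> ring

/-- Integration by parts in the normal variable, exchanging the even and odd reflections. -/
theorem integral_reflect_mul_fderiv (m : ℕ) {h h' : HalfSpacePt m → ℝ} (hc : Continuous h)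
    (hc' : Continuous h')
    (hd : ∀ z, HasDerivAt (fun s : ℝ => h (z + s • coordVec m (Fin.last m))) (h' z) 0)
    {θ : HalfSpacePt m → ℝ} (hθ : ContDiff ℝ (⊤ : ℕ∞) θ) (hθc : HasCompactSupport θ)
    (hθs : tsupport θ ⊆ halfSpace m) (x : HalfSpacePt m) :
    ∫ y in halfSpace m, (h (x.1 - y.1, x.2 - y.2) + h (x.1 - y.1, x.2 + y.2)) *
        fderiv ℝ θ y (0, 1) =
      ∫ y in halfSpace m, (h' (x.1 - y.1, x.2 - y.2) - h' (x.1 - y.1, x.2 + y.2)) * θ y := by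
  have hfs : tsupport (fun y => fderiv ℝ θ y (0, 1)) ⊆ tsupport θ :=
    tsupport_fderiv_apply_subset ℝ _
  have hfc : Continuous fun y => fderiv ℝ θ y (0, 1) :=
    (hθ.continuous_fderiv (by simp)).clm_apply continuous_const
  have hfcs : HasCompactSupport fun y => fderiv ℝ θ y (0, 1) := hθc.fderiv_apply ℝ _
  rw [setIntegral_eq_integral_of_forall_compl_eq_zero (fun y hy => by
      rw [image_eq_zero_of_notMem_tsupport (f := fun y => fderiv ℝ θ y (0, 1))
        (fun h => hy (hθs (hfs h))), mul_zero]),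
    setIntegral_eq_integral_of_forall_compl_eq_zero (fun y hy => by
      rw [image_eq_zero_of_notMem_tsupport (fun h => hy (hθs h)), mul_zero])]
  have key := integral_bilinear_hasLineDerivAt_right_eq_neg_left_of_integrable
    (μ := (volume : Measure (HalfSpacePt m))) (B := ContinuousLinearMap.mul ℝ ℝ) (v := (0, 1))
    (f := fun y => h (x.1 - y.1, x.2 - y.2) + h (x.1 - y.1, x.2 + y.2))
    (f' := fun y => -(h' (x.1 - y.1, x.2 - y.2) - h' (x.1 - y.1, x.2 + y.2)))
    (g := θ) (g' := fun y => fderiv ℝ θ y (0, 1))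
    (Continuous.integrable_of_hasCompactSupport
      (by have := hθ.continuous; simp only [ContinuousLinearMap.mul_apply']; fun_prop)
      (by simpa only [ContinuousLinearMap.mul_apply', Pi.mul_def] using hθc.mul_left))
    (Continuous.integrable_of_hasCompactSupport
      (by simp only [ContinuousLinearMap.mul_apply']; fun_prop)
      (by simpa only [ContinuousLinearMap.mul_apply', Pi.mul_def] using hfcs.mul_left))
    (Continuous.integrable_of_hasCompactSupport
      (by have := hθ.continuous; simp only [ContinuousLinearMap.mul_apply']; fun_prop)
      (by simpa only [ContinuousLinearMap.mul_apply', Pi.mul_def] using hθc.mul_left))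
    (fun y _ => by
      have h1 := hd (x.1 - y.1, x.2 - y.2)
      have h2 := hd (x.1 - y.1, x.2 + y.2)
      rw [coordVec_last] at h1 h2
      have h3 := HasDerivAt.scomp (0 : ℝ) (by simpa using h1) (hasDerivAt_neg (0 : ℝ))
      unfold HasLineDerivAt
      convert! h3.add h2 using 1
      · ext s
        simp [Function.comp_def]
        ring_nf
      · simp; ring)
    (fun y _ => (hθ.differentiable (by simp) y).hasFDerivAt.hasLineDerivAt _)
  simp only [ContinuousLinearMap.mul_apply', neg_mul, integral_neg, neg_neg] at key
  exact key

/-- The derivative `∂_k F(t) f`, as an integral against the differentiated kernel. -/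
def FheatD (m : ℕ) (k : Fin (m + 1)) (t : ℝ) (f : HalfSpacePt m → ℝ) (x : HalfSpacePt m) : ℝ :=
  ∫ y in halfSpace m,
    (gaussD m k t (x.1 - y.1, x.2 - y.2) + gaussD m k t (x.1 - y.1, x.2 + y.2)) * f y

theorem measurableSet_halfSpace (m : ℕ) : MeasurableSet (halfSpace m) :=
  (isOpen_lt continuous_const continuous_snd).measurableSet

theorem gauss_le (m : ℕ) {t : ℝ} (ht : 0 < t) (z : HalfSpacePt m) :
    gauss m t z ≤ (4 * Real.pi * t) ^ (-((m : ℝ) + 1) / 2) := by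
  refine mul_le_of_le_one_right (by positivity) (Real.exp_le_one_iff.2 ?_)
  refine div_nonpos_of_nonpos_of_nonneg (neg_nonpos.2 ?_) (by positivity)
  positivity

theorem hasDerivAt_Fheat_line (m : ℕ) (k : Fin (m + 1)) {t : ℝ} (ht : 0 < t)
    {f : HalfSpacePt m → ℝ} (hf : Continuous f) (hfc : HasCompactSupport f)
    (x : HalfSpacePt m) (s : ℝ) :
    HasDerivAt (fun s : ℝ => Fheat m t f (x + s • coordVec m k))
      (FheatD m k t f (x + s • coordVec m k)) s := by
  have hcg := continuous_gauss m t
  have hcd := continuous_gaussD m k t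
  set A := doublingConst m * (√t)⁻¹ * (4 * Real.pi * (2 * t)) ^ (-((m : ℝ) + 1) / 2)
  have hA : ∀ z, |gaussD m k t z| ≤ A := fun z => (abs_gaussD_le m k ht z).trans <|
    mul_le_mul_of_nonneg_left (gauss_le m (by positivity) z)
      (mul_nonneg (doublingConst_pos m).le (by positivity))
  refine (hasDerivAt_integral_of_dominated_loc_of_deriv_le (μ := volume.restrict (halfSpace m))
    (bound := fun y => 2 * A * |f y|) (s := Set.univ) (x₀ := s)
    (F := fun s y => (gauss m t ((x + s • coordVec m k).1 - y.1, (x + s • coordVec m k).2 - y.2) +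
      gauss m t ((x + s • coordVec m k).1 - y.1, (x + s • coordVec m k).2 + y.2)) * f y)
    (F' := fun s y =>
      (gaussD m k t ((x + s • coordVec m k).1 - y.1, (x + s • coordVec m k).2 - y.2) +
      gaussD m k t ((x + s • coordVec m k).1 - y.1, (x + s • coordVec m k).2 + y.2)) * f y)
    Filter.univ_mem ?_ ?_ ?_ ?_ ?_ ?_).2
  · exact .of_forall fun s => Continuous.aestronglyMeasurable (by fun_prop)
  · refine (Continuous.integrable_of_hasCompactSupport (by fun_prop) ?_).integrableOn
    exact hfc.mul_left (f := fun y : HalfSpacePt m =>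
      gauss m t ((x + s • coordVec m k).1 - y.1, (x + s • coordVec m k).2 - y.2) +
        gauss m t ((x + s • coordVec m k).1 - y.1, (x + s • coordVec m k).2 + y.2))
  · exact Continuous.aestronglyMeasurable (by fun_prop)
  · refine .of_forall fun y s _ => ?_
    rw [norm_mul, Real.norm_eq_abs, Real.norm_eq_abs]
    gcongr
    refine (abs_add_le _ _).trans ?_
    linarith [hA ((x + s • coordVec m k).1 - y.1, (x + s • coordVec m k).2 - y.2),
      hA ((x + s • coordVec m k).1 - y.1, (x + s • coordVec m k).2 + y.2)]
  · exact ((hf.integrable_of_hasCompactSupport hfc).abs.const_mul _).integrableOn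
  · refine .of_forall fun y s _ => ?_
    have h1 := hasDerivAt_gauss_line m k ht (x.1 - y.1, x.2 - y.2) s
    have h2 := hasDerivAt_gauss_line m k ht (x.1 - y.1, x.2 + y.2) s
    have e1 : ∀ s : ℝ, ((x + s • coordVec m k).1 - y.1, (x + s • coordVec m k).2 - y.2) =
        ((x.1 - y.1, x.2 - y.2) : HalfSpacePt m) + s • coordVec m k := fun s => by
      ext <;> simp <;> ring
    have e2 : ∀ s : ℝ, ((x + s • coordVec m k).1 - y.1, (x + s • coordVec m k).2 + y.2) =
        ((x.1 - y.1, x.2 + y.2) : HalfSpacePt m) + s • coordVec m k := fun s => by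
      ext <;> simp <;> ring
    simp only [e1, e2]
    exact (h1.add h2).mul_const (f y)

theorem aestronglyMeasurable_Fheat (m : ℕ) {f : HalfSpacePt m → ℝ} (hf : Measurable f)
    (x : HalfSpacePt m) {μ : Measure ℝ} :
    AEStronglyMeasurable (fun t => Fheat m t f x) μ := by
  have hg := measurable_gauss m
  refine StronglyMeasurable.aestronglyMeasurable ?_
  refine StronglyMeasurable.integral_prod_right' (f := fun p : ℝ × HalfSpacePt m =>
    (gauss m p.1 (x.1 - p.2.1, x.2 - p.2.2) + gauss m p.1 (x.1 - p.2.1, x.2 + p.2.2)) * f p.2) ?_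
  refine Measurable.stronglyMeasurable (((Measurable.comp hg (f := fun p : ℝ × HalfSpacePt m =>
    (p.1, ((x.1 - p.2.1, x.2 - p.2.2) : HalfSpacePt m))) (by fun_prop)).add
    (Measurable.comp hg (f := fun p : ℝ × HalfSpacePt m =>
    (p.1, ((x.1 - p.2.1, x.2 + p.2.2) : HalfSpacePt m))) (by fun_prop))).mul (by fun_prop))

theorem aestronglyMeasurable_FheatD (m : ℕ) (k : Fin (m + 1)) {f : HalfSpacePt m → ℝ}
    (hf : Measurable f) (x : HalfSpacePt m) {μ : Measure ℝ} :
    AEStronglyMeasurable (fun t => FheatD m k t f x) μ := by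
  have hg := measurable_gaussD m k
  refine StronglyMeasurable.aestronglyMeasurable ?_
  refine StronglyMeasurable.integral_prod_right' (f := fun p : ℝ × HalfSpacePt m =>
    (gaussD m k p.1 (x.1 - p.2.1, x.2 - p.2.2) + gaussD m k p.1 (x.1 - p.2.1, x.2 + p.2.2)) *
      f p.2) ?_
  refine Measurable.stronglyMeasurable (((Measurable.comp hg (f := fun p : ℝ × HalfSpacePt m =>
    (p.1, ((x.1 - p.2.1, x.2 - p.2.2) : HalfSpacePt m))) (by fun_prop)).add
    (Measurable.comp hg (f := fun p : ℝ × HalfSpacePt m =>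
    (p.1, ((x.1 - p.2.1, x.2 + p.2.2) : HalfSpacePt m))) (by fun_prop))).mul (by fun_prop))

/-- A kernel dominated by `c · w · G_t` on the half-space gives a convolution bound. -/
theorem enorm_setIntegral_mul_le (m : ℕ) {t c : ℝ} (ht : 0 < t) (hc : 0 ≤ c)
    {K w f : HalfSpacePt m → ℝ} {x : HalfSpacePt m}
    (hK : ∀ y ∈ halfSpace m, |K y| ≤ c * w y * gauss m t (x - y)) :
    ‖∫ y in halfSpace m, K y * f y‖ₑ ≤
      ENNReal.ofReal c * ∫⁻ y, ENNReal.ofReal (gauss m t (x - y)) * ‖w y * f y‖ₑ := by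
  calc _ ≤ ∫⁻ y in halfSpace m, ‖K y * f y‖ₑ := enorm_integral_le_lintegral_enorm _
    _ ≤ ∫⁻ y in halfSpace m,
        ENNReal.ofReal c * (ENNReal.ofReal (gauss m t (x - y)) * ‖w y * f y‖ₑ) := by
      refine setLIntegral_mono' (measurableSet_halfSpace m) fun y hy => ?_
      have hg := gauss_nonneg m ht (x - y)
      rw [← ofReal_norm, ← ofReal_norm, ← ENNReal.ofReal_mul hg, ← ENNReal.ofReal_mul hc]
      refine ENNReal.ofReal_le_ofReal ?_
      simp only [norm_mul, Real.norm_eq_abs]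
      calc _ ≤ c * w y * gauss m t (x - y) * |f y| := by gcongr; exact hK y hy
        _ ≤ c * |w y| * gauss m t (x - y) * |f y| := by gcongr; exact le_abs_self _
        _ = _ := by ring
    _ ≤ ∫⁻ y, ENNReal.ofReal c * (ENNReal.ofReal (gauss m t (x - y)) * ‖w y * f y‖ₑ) :=
      setLIntegral_le_lintegral _ _
    _ = _ := lintegral_const_mul' _ _ ENNReal.ofReal_ne_top

theorem enorm_FheatD_le (m : ℕ) (k : Fin (m + 1)) {t : ℝ} (ht : 0 < t) (f : HalfSpacePt m → ℝ)
    {x : HalfSpacePt m} (hx : 0 < x.2) :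
    ‖FheatD m k t f x‖ₑ ≤ ENNReal.ofReal (2 * doublingConst m * (√t)⁻¹) *
      ∫⁻ y, ENNReal.ofReal (gauss m (2 * t) (x - y)) * ‖f y‖ₑ := by
  have hd := doublingConst_pos m
  have h := enorm_setIntegral_mul_le m (t := 2 * t) (c := 2 * doublingConst m * (√t)⁻¹)
    (by positivity) (by positivity) (w := fun _ => 1) (f := f) (x := x)
    (K := fun y => gaussD m k t (x.1 - y.1, x.2 - y.2) + gaussD m k t (x.1 - y.1, x.2 + y.2))
    (fun y hy => by
      have h1 := abs_gaussD_le m k ht (x.1 - y.1, x.2 - y.2)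
      have h2 := abs_gaussD_le m k ht (x.1 - y.1, x.2 + y.2)
      have h3 := mul_le_mul_of_nonneg_left
        (gauss_reflect_le m (show 0 < 2 * t by positivity) hx hy)
        (show 0 ≤ doublingConst m * (√t)⁻¹ by positivity)
      refine (abs_add_le _ _).trans ?_
      change _ ≤ 2 * doublingConst m * (√t)⁻¹ * 1 * gauss m (2 * t) (x.1 - y.1, x.2 - y.2)
      linarith)
  simp only [one_mul] at h
  exact h

theorem enorm_Fheat_le (m : ℕ) {t : ℝ} (ht : 0 < t) (f : HalfSpacePt m → ℝ)
    {x : HalfSpacePt m} (hx : 0 < x.2) :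
    ‖Fheat m t f x‖ₑ ≤ ENNReal.ofReal 2 *
      ∫⁻ y, ENNReal.ofReal (gauss m t (x - y)) * ‖f y‖ₑ := by
  have h := enorm_setIntegral_mul_le m (c := 2) ht
    (by positivity) (w := fun _ => 1) (f := f) (x := x)
    (K := fun y => gauss m t (x.1 - y.1, x.2 - y.2) + gauss m t (x.1 - y.1, x.2 + y.2))
    (fun y hy => by
      have h3 := gauss_reflect_le m ht hx hy
      rw [abs_of_nonneg (add_nonneg (gauss_nonneg m ht _) (gauss_nonneg m ht _))]
      change _ ≤ 2 * 1 * gauss m t (x.1 - y.1, x.2 - y.2)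
      linarith)
  simp only [one_mul] at h
  exact h

section NormalDerivative

variable {m : ℕ} {θ : HalfSpacePt m → ℝ}

theorem enorm_FheatD_fderiv_le (hθ : ContDiff ℝ (⊤ : ℕ∞) θ) (hθc : HasCompactSupport θ)
    (hθs : tsupport θ ⊆ halfSpace m) (k : Fin (m + 1)) {t : ℝ} (ht : 0 < t)
    {x : HalfSpacePt m} (hx : 0 < x.2) :
    ‖FheatD m k t (fun y => fderiv ℝ θ y (0, 1)) x‖ₑ ≤
      ENNReal.ofReal (16 * doublingConst m * (t * √t)⁻¹) *
        ∫⁻ y, ENNReal.ofReal (gauss m (2 * t) (x - y)) * ‖y.2 * θ y‖ₑ := by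
  have hd := doublingConst_pos m
  rw [FheatD, integral_reflect_mul_fderiv m (continuous_gaussD m k t) (continuous_gaussDD m k t)
    (fun z => by simpa using hasDerivAt_gaussD_line m k ht z 0) hθ hθc hθs]
  exact enorm_setIntegral_mul_le m (by positivity) (by positivity) fun y hy =>
    abs_gaussDD_sub_le m k ht (x.1 - y.1) hx hy

theorem enorm_Fheat_fderiv_le (hθ : ContDiff ℝ (⊤ : ℕ∞) θ) (hθc : HasCompactSupport θ)
    (hθs : tsupport θ ⊆ halfSpace m) {t : ℝ} (ht : 0 < t)
    {x : HalfSpacePt m} (hx : 0 < x.2) :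
    ‖Fheat m t (fun y => fderiv ℝ θ y (0, 1)) x‖ₑ ≤
      ENNReal.ofReal (4 * doublingConst m * t⁻¹) *
        ∫⁻ y, ENNReal.ofReal (gauss m (2 * t) (x - y)) * ‖y.2 * θ y‖ₑ := by
  have hd := doublingConst_pos m
  rw [Fheat, integral_reflect_mul_fderiv m (continuous_gauss m t)
    (continuous_gaussD m (Fin.last m) t)
    (fun z => by simpa using hasDerivAt_gauss_line m (Fin.last m) ht z 0) hθ hθc hθs]
  exact enorm_setIntegral_mul_le m (by positivity) (by positivity) fun y hy =>
    abs_gaussD_last_sub_le' m ht (x.1 - y.1) hx hy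

end NormalDerivative

/-- The time weight `t^{-1/2}` for `t ≤ 1` and `t^{-3/2}` for `t > 1`. -/
def timeWeight (t : ℝ) : ℝ := if t ≤ 1 then (√t)⁻¹ else (t * √t)⁻¹

theorem inv_sqrt_eq_rpow {t : ℝ} (ht : 0 < t) : (√t)⁻¹ = t ^ (-1 / 2 : ℝ) := by
  rw [Real.sqrt_eq_rpow, ← Real.rpow_neg ht.le]; norm_num

theorem inv_mul_sqrt_eq_rpow {t : ℝ} (ht : 0 < t) : (t * √t)⁻¹ = t ^ (-3 / 2 : ℝ) := by
  rw [mul_inv, inv_sqrt_eq_rpow ht, ← Real.rpow_neg_one t, ← Real.rpow_add ht]; norm_num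

theorem integrableOn_inv_sqrt : IntegrableOn (fun t : ℝ => (√t)⁻¹) (Set.Ioc 0 1) := by
  refine IntegrableOn.congr_fun (f := fun t : ℝ => t ^ (-1 / 2 : ℝ)) ?_
    (fun t ht => (inv_sqrt_eq_rpow ht.1).symm) measurableSet_Ioc
  exact (intervalIntegrable_iff_integrableOn_Ioc_of_le zero_le_one).1
    (intervalIntegral.intervalIntegrable_rpow' (by norm_num))

theorem integrableOn_inv_mul_sqrt : IntegrableOn (fun t : ℝ => (t * √t)⁻¹) (Set.Ioi 1) := by
  refine IntegrableOn.congr_fun (f := fun t : ℝ => t ^ (-3 / 2 : ℝ)) ?_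
    (fun t ht => (inv_mul_sqrt_eq_rpow (zero_lt_one.trans ht)).symm) measurableSet_Ioi
  exact integrableOn_Ioi_rpow_of_lt (by norm_num) zero_lt_one

theorem integrableOn_timeWeight : IntegrableOn timeWeight (Set.Ioi 0) := by
  rw [← Set.Ioc_union_Ioi_eq_Ioi zero_le_one]
  refine IntegrableOn.union ?_ ?_
  · exact integrableOn_inv_sqrt.congr_fun (fun t ht => by simp [timeWeight, ht.2]) measurableSet_Ioc
  · exact integrableOn_inv_mul_sqrt.congr_fun
      (fun t ht => by simp [timeWeight, not_le.2 (show 1 < t from ht)]) measurableSet_Ioi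

theorem lintegral_gauss_mul_le (m : ℕ) {t : ℝ} (ht : 0 < t) {φ : HalfSpacePt m → ℝ≥0∞}
    {M : ℝ≥0∞} (hM : ∀ y, φ y ≤ M) (x : HalfSpacePt m) :
    ∫⁻ y, ENNReal.ofReal (gauss m t (x - y)) * φ y ≤ M := by
  have hg : Measurable (gauss m t) := (continuous_gauss m t).measurable
  calc _ ≤ ∫⁻ y, ENNReal.ofReal (gauss m t (x - y)) * M := by gcongr; exact hM _
    _ = (∫⁻ y, ENNReal.ofReal (gauss m t (x - y))) * M := lintegral_mul_const _ (by fun_prop)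
    _ = M := by
      rw [lintegral_sub_left_eq_self (fun z => ENNReal.ofReal (gauss m t z)) x,
        lintegral_gauss m ht, one_mul]

theorem gauss_two_mul_le_inv_sqrt (m : ℕ) {t : ℝ} (ht : 1 ≤ t) (z : HalfSpacePt m) :
    gauss m (2 * t) z ≤ (√t)⁻¹ := by
  have h0 : 0 < t := by linarith
  refine (gauss_le m (by positivity) z).trans ?_
  have hm : (0 : ℝ) ≤ m := Nat.cast_nonneg m
  rw [inv_sqrt_eq_rpow h0]
  calc _ ≤ t ^ (-((m : ℝ) + 1) / 2) :=
        Real.rpow_le_rpow_of_nonpos h0 (by nlinarith [Real.pi_gt_three]) (by linarith)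
    _ ≤ _ := Real.rpow_le_rpow_of_exponent_le ht (by linarith)

section NormalDerivative

variable {m : ℕ} {θ : HalfSpacePt m → ℝ}

theorem continuous_fderiv_normal (hθ : ContDiff ℝ (⊤ : ℕ∞) θ) :
    Continuous fun y => fderiv ℝ θ y ((0, 1) : HalfSpacePt m) :=
  (hθ.continuous_fderiv (by simp)).clm_apply continuous_const

theorem hasCompactSupport_fderiv_normal (hθc : HasCompactSupport θ) :
    HasCompactSupport fun y => fderiv ℝ θ y ((0, 1) : HalfSpacePt m) :=
  hθc.fderiv_apply ℝ _

theorem exists_norm_Fheat_fderiv_le (hθ : ContDiff ℝ (⊤ : ℕ∞) θ) (hθc : HasCompactSupport θ)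
    (hθs : tsupport θ ⊆ halfSpace m) (k : Fin (m + 1)) :
    ∃ C, ∀ t > 0, ∀ x : HalfSpacePt m, 0 < x.2 →
      ‖Fheat m t (fun y => fderiv ℝ θ y (0, 1)) x‖ ≤ C * timeWeight t ∧
      ‖FheatD m k t (fun y => fderiv ℝ θ y (0, 1)) x‖ ≤ C * timeWeight t := by
  have hd := doublingConst_pos m
  have hwc : Continuous fun y : HalfSpacePt m => y.2 * θ y := by
    have := hθ.continuous
    fun_prop
  have hws : HasCompactSupport fun y : HalfSpacePt m => y.2 * θ y := hθc.mul_left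
  obtain ⟨M₁, hM₁⟩ :=
    (hasCompactSupport_fderiv_normal hθc).exists_bound_of_continuous (continuous_fderiv_normal hθ)
  obtain ⟨M₂, hM₂⟩ := hws.exists_bound_of_continuous hwc
  have hM₁0 : 0 ≤ M₁ := (norm_nonneg _).trans (hM₁ 0)
  have hM₂0 : 0 ≤ M₂ := (norm_nonneg _).trans (hM₂ 0)
  have hN : ∫⁻ y : HalfSpacePt m, ‖y.2 * θ y‖ₑ ≠ ∞ :=
    (hwc.integrable_of_hasCompactSupport hws).2.ne
  set N := (∫⁻ y : HalfSpacePt m, ‖y.2 * θ y‖ₑ).toReal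
  have hN0 : 0 ≤ N := ENNReal.toReal_nonneg
  have h₁ := mul_nonneg hd.le hM₁0
  have h₂ := mul_nonneg hd.le hM₂0
  have h₃ := mul_nonneg hd.le hN0
  have hM₁e : ∀ y, ‖fderiv ℝ θ y ((0, 1) : HalfSpacePt m)‖ₑ ≤ ENNReal.ofReal M₁ := fun y => by
    rw [← ofReal_norm]; exact ENNReal.ofReal_le_ofReal (hM₁ y)
  have hM₂e : ∀ y : HalfSpacePt m, ‖y.2 * θ y‖ₑ ≤ ENNReal.ofReal M₂ := fun y => by
    rw [← ofReal_norm]; exact ENNReal.ofReal_le_ofReal (hM₂ y)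
  have key : ∀ {a b : ℝ} {c d : ℝ}, 0 ≤ c → 0 ≤ d → c * d ≤ b →
      ‖a‖ₑ ≤ ENNReal.ofReal c * ENNReal.ofReal d → ‖a‖ ≤ b := fun hc hd hb h => by
    rw [← ofReal_norm, ← ENNReal.ofReal_mul hc,
      ENNReal.ofReal_le_ofReal_iff (mul_nonneg hc hd)] at h
    exact h.trans hb
  refine ⟨2 * M₁ + 4 * doublingConst m * N + 2 * doublingConst m * M₁ +
    16 * doublingConst m * M₂, fun t ht x hx => ?_⟩
  have hst := Real.sqrt_pos.2 ht
  rw [timeWeight]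
  split_ifs with h1
  · have hs1 : 1 ≤ (√t)⁻¹ := (one_le_inv₀ hst).2 (Real.sqrt_le_one.2 h1)
    constructor
    · refine key (c := 2) (d := M₁) (by norm_num) hM₁0 ?_ ((enorm_Fheat_le m ht _ hx).trans
        (mul_le_mul_right (lintegral_gauss_mul_le m ht hM₁e x) _))
      calc 2 * M₁ ≤ (2 * M₁) * (√t)⁻¹ := le_mul_of_one_le_right (by positivity) hs1
        _ ≤ _ := by gcongr; linarith
    · refine key (c := 2 * doublingConst m * (√t)⁻¹) (d := M₁) (by positivity) hM₁0 ?_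
        ((enorm_FheatD_le m k ht _ hx).trans
        (mul_le_mul_right (lintegral_gauss_mul_le m (by positivity) hM₁e x) _))
      calc _ = (2 * doublingConst m * M₁) * (√t)⁻¹ := by ring
        _ ≤ _ := by gcongr; linarith
  · push Not at h1
    constructor
    · refine key (c := 4 * doublingConst m * t⁻¹) (d := (√t)⁻¹ * N) (by positivity) (by positivity)
        ?_ ((enorm_Fheat_fderiv_le hθ hθc hθs ht hx).trans (mul_le_mul_right ?_ _))
      · calc _ = (4 * doublingConst m * N) * (t * √t)⁻¹ := by rw [mul_inv]; ring
          _ ≤ _ := by gcongr; linarith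
      · rw [ENNReal.ofReal_mul (by positivity), ENNReal.ofReal_toReal hN,
          ← lintegral_const_mul' _ _ ENNReal.ofReal_ne_top]
        gcongr
        exact gauss_two_mul_le_inv_sqrt m h1.le _
    · refine key (c := 16 * doublingConst m * (t * √t)⁻¹) (d := M₂) (by positivity) hM₂0 ?_
        ((enorm_FheatD_fderiv_le hθ hθc hθs k ht hx).trans
        (mul_le_mul_right (lintegral_gauss_mul_le m (by positivity) hM₂e x) _))
      calc _ = (16 * doublingConst m * M₂) * (t * √t)⁻¹ := by ring
        _ ≤ _ := by gcongr; linarith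

theorem coordVec_snd_nonneg (m : ℕ) (k : Fin (m + 1)) :
    0 ≤ (coordVec m k).2 ∧ (coordVec m k).2 ≤ 1 := by
  unfold coordVec; split_ifs <;> simp

theorem hasDerivAt_neumannPotential_line (hθ : ContDiff ℝ (⊤ : ℕ∞) θ) (hθc : HasCompactSupport θ)
    (hθs : tsupport θ ⊆ halfSpace m) (k : Fin (m + 1)) {x : HalfSpacePt m} (hx : 0 < x.2) :
    HasDerivAt (fun s : ℝ =>
        neumannPotential m (fun y => fderiv ℝ θ y (0, 1)) (x + s • coordVec m k))
      (∫ τ in Set.Ioi (0 : ℝ), FheatD m k τ (fun y => fderiv ℝ θ y (0, 1)) x) 0 := by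
  obtain ⟨C, hC⟩ := exists_norm_Fheat_fderiv_le hθ hθc hθs k
  have hf := continuous_fderiv_normal hθ
  have hpos : ∀ s ∈ Metric.ball (0 : ℝ) x.2, 0 < (x + s • coordVec m k).2 := fun s hs => by
    obtain ⟨h0, h1⟩ := coordVec_snd_nonneg m k
    rw [mem_ball_zero_iff, Real.norm_eq_abs, abs_lt] at hs
    simp only [Prod.snd_add, Prod.smul_snd, smul_eq_mul]
    nlinarith
  have hint := integrableOn_timeWeight.const_mul C
  have h := (hasDerivAt_integral_of_dominated_loc_of_deriv_le
    (μ := volume.restrict (Set.Ioi (0 : ℝ))) (bound := fun t => C * timeWeight t)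
    (s := Metric.ball 0 x.2) (x₀ := (0 : ℝ))
    (F := fun s t => Fheat m t (fun y => fderiv ℝ θ y (0, 1)) (x + s • coordVec m k))
    (F' := fun s t => FheatD m k t (fun y => fderiv ℝ θ y (0, 1)) (x + s • coordVec m k))
    (Metric.ball_mem_nhds _ hx) ?_ ?_ ?_ ?_ hint ?_).2
  · simp only [zero_smul, add_zero] at h
    exact h
  · exact .of_forall fun s => aestronglyMeasurable_Fheat m hf.measurable _
  · refine hint.mono' (aestronglyMeasurable_Fheat m hf.measurable _) ?_
    filter_upwards [ae_restrict_mem measurableSet_Ioi] with t ht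
    exact (hC t ht _ (hpos 0 (Metric.mem_ball_self hx))).1
  · exact aestronglyMeasurable_FheatD m k hf.measurable _
  · filter_upwards [ae_restrict_mem measurableSet_Ioi] with t ht s hs
    exact (hC t ht _ (hpos s hs)).2
  · filter_upwards [ae_restrict_mem measurableSet_Ioi] with t ht s hs
    exact hasDerivAt_Fheat_line m k ht hf (hasCompactSupport_fderiv_normal hθc) x s

theorem enorm_fderiv_neumannPotential_le (hθ : ContDiff ℝ (⊤ : ℕ∞) θ)
    (hθc : HasCompactSupport θ) (hθs : tsupport θ ⊆ halfSpace m) (k : Fin (m + 1))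
    {x : HalfSpacePt m} (hx : 0 < x.2) :
    ‖fderiv ℝ (neumannPotential m fun y => fderiv ℝ θ y (0, 1)) x (coordVec m k)‖ₑ ≤
      ∫⁻ τ in Set.Ioi (0 : ℝ), ‖FheatD m k τ (fun y => fderiv ℝ θ y (0, 1)) x‖ₑ := by
  by_cases hd : DifferentiableAt ℝ (neumannPotential m fun y => fderiv ℝ θ y (0, 1)) x
  · have h := hd.hasFDerivAt.hasLineDerivAt (coordVec m k)
    rw [h.unique (hasDerivAt_neumannPotential_line hθ hθc hθs k hx)]
    exact enorm_integral_le_lintegral_enorm _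
  · simp [fderiv_zero_of_not_differentiableAt hd]

end NormalDerivative

/-- The Gauss kernel `G_{2t}` averaged over times in `S` with weight `c`. -/
def gaussAverage (m : ℕ) (S : Set ℝ) (c : ℝ → ℝ) (z : HalfSpacePt m) : ℝ≥0∞ :=
  ∫⁻ t in S, ENNReal.ofReal (c t) * ENNReal.ofReal (gauss m (2 * t) z)

section GaussAverage

variable (m : ℕ) {S : Set ℝ} {c : ℝ → ℝ}

theorem measurable_gaussAverage (hc : Measurable c) : Measurable (gaussAverage m S c) := by
  have hg := measurable_gauss m
  refine Measurable.lintegral_prod_right' (f := fun p : HalfSpacePt m × ℝ =>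
    ENNReal.ofReal (c p.2) * ENNReal.ofReal (gauss m (2 * p.2) p.1)) ?_
  have := Measurable.comp hg (f := fun p : HalfSpacePt m × ℝ => (2 * p.2, p.1)) (by fun_prop)
  exact ((hc.comp measurable_snd).ennreal_ofReal).mul this.ennreal_ofReal

theorem lintegral_gaussAverage (hS : MeasurableSet S) (hS0 : S ⊆ Set.Ioi 0) (hc : Measurable c) :
    ∫⁻ z, gaussAverage m S c z = ∫⁻ t in S, ENNReal.ofReal (c t) := by
  have hg := measurable_gauss m
  have h2 := Measurable.comp hg (f := fun p : HalfSpacePt m × ℝ => (2 * p.2, p.1)) (by fun_prop)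
  simp only [gaussAverage]
  rw [lintegral_lintegral_swap (((hc.comp measurable_snd).ennreal_ofReal).mul
    h2.ennreal_ofReal).aemeasurable]
  refine setLIntegral_congr_fun hS fun t ht => ?_
  have ht0 : 0 < t := hS0 ht
  rw [lintegral_const_mul' _ _ ENNReal.ofReal_ne_top, lintegral_gauss m (by positivity), mul_one]

theorem lintegral_gaussAverage_mul (hc : Measurable c) {φ : HalfSpacePt m → ℝ≥0∞}
    (hφ : Measurable φ) (x : HalfSpacePt m) :
    ∫⁻ t in S, ENNReal.ofReal (c t) * ∫⁻ y, ENNReal.ofReal (gauss m (2 * t) (x - y)) * φ y =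
      ∫⁻ y, gaussAverage m S c (x - y) * φ y := by
  have hg := measurable_gauss m
  have h2 := Measurable.comp hg (f := fun p : ℝ × HalfSpacePt m => (2 * p.1, x - p.2))
    (by fun_prop)
  calc _ = ∫⁻ t in S, ∫⁻ y, ENNReal.ofReal (c t) *
        (ENNReal.ofReal (gauss m (2 * t) (x - y)) * φ y) := by
        simp_rw [lintegral_const_mul' _ _ ENNReal.ofReal_ne_top]
    _ = ∫⁻ y, ∫⁻ t in S, ENNReal.ofReal (c t) *
        (ENNReal.ofReal (gauss m (2 * t) (x - y)) * φ y) :=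
      lintegral_lintegral_swap (((hc.comp measurable_fst).ennreal_ofReal).mul
        (h2.ennreal_ofReal.mul (hφ.comp measurable_snd))).aemeasurable
    _ = _ := by
      refine lintegral_congr fun y => ?_
      simp_rw [← mul_assoc, gaussAverage]
      refine lintegral_mul_const _ ?_
      have := Measurable.comp hg (f := fun t : ℝ => (2 * t, x - y)) (by fun_prop)
      exact hc.ennreal_ofReal.mul this.ennreal_ofReal

end GaussAverage

/-- for `1 ≤ k ≤ n`, `1 ≤ q ≤ ∞` there is `C = C(n,q) > 0` with
`‖∂_k 𝒩(∂ₙθ)‖_{L^q(ℝⁿ₊)} ≤ C (‖∂ₙθ‖_{L^q(ℝⁿ₊)} + ‖yₙθ‖_{L^q(ℝⁿ₊)})`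
for every `θ ∈ C_c^∞(ℝⁿ₊)` (`n = m + 1`). -/
theorem neumannPotential_deriv_Lq_bound (m : ℕ) (k : Fin (m + 1)) (q : ℝ≥0∞)
    (hq : 1 ≤ q) :
    ∃ C : ℝ, 0 < C ∧ ∀ θ : HalfSpacePt m → ℝ,
      ContDiff ℝ (⊤ : ℕ∞) θ → HasCompactSupport θ → tsupport θ ⊆ halfSpace m →
      eLpNorm
          (fun x : HalfSpacePt m =>
            fderiv ℝ (neumannPotential m fun y => fderiv ℝ θ y (0, 1)) x (coordVec m k))
          q (volume.restrict (halfSpace m)) ≤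
        ENNReal.ofReal C *
          (eLpNorm (fun y : HalfSpacePt m => fderiv ℝ θ y (0, 1)) q
              (volume.restrict (halfSpace m)) +
            eLpNorm (fun y : HalfSpacePt m => y.2 * θ y) q
              (volume.restrict (halfSpace m))) := by
  have hd := doublingConst_pos m
  set c₁ : ℝ → ℝ := fun t => 2 * doublingConst m * (√t)⁻¹
  set c₂ : ℝ → ℝ := fun t => 16 * doublingConst m * (t * √t)⁻¹
  have hc₁ : Measurable c₁ := by fun_prop
  have hc₂ : Measurable c₂ := by fun_prop
  set L₁ := gaussAverage m (Set.Ioc 0 1) c₁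
  set L₂ := gaussAverage m (Set.Ioi 1) c₂
  have hL₁ : Measurable L₁ := measurable_gaussAverage m hc₁
  have hL₂ : Measurable L₂ := measurable_gaussAverage m hc₂
  have hW₁ : ∫⁻ z, L₁ z ≠ ∞ := by
    rw [lintegral_gaussAverage m measurableSet_Ioc (fun t ht => ht.1) hc₁]
    exact (integrableOn_inv_sqrt.const_mul _).lintegral_lt_top.ne
  have hW₂ : ∫⁻ z, L₂ z ≠ ∞ := by
    rw [lintegral_gaussAverage m measurableSet_Ioi
      (fun t ht => zero_lt_one.trans (Set.mem_Ioi.1 ht)) hc₂]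
    exact (integrableOn_inv_mul_sqrt.const_mul _).lintegral_lt_top.ne
  refine ⟨(∫⁻ z, L₁ z).toReal + (∫⁻ z, L₂ z).toReal + 1, by positivity, fun θ hθ hθc hθs => ?_⟩
  set f : HalfSpacePt m → ℝ := fun y => fderiv ℝ θ y (0, 1) with hf_def
  set g : HalfSpacePt m → ℝ := fun y => y.2 * θ y with hg_def
  have hf : Measurable f := (continuous_fderiv_normal hθ).measurable
  have hg : Measurable g := by
    have := hθ.continuous.measurable
    fun_prop
  have hfs : Function.support f ⊆ halfSpace m := fun y hy => hθs <|
    support_fderiv_subset ℝ fun h : fderiv ℝ θ y = 0 => hy (by simp [hf_def, h])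
  have hgs : Function.support g ⊆ halfSpace m := fun y hy =>
    hθs (subset_tsupport θ fun h : θ y = 0 => hy (by simp [hg_def, h]))
  have hS : Measurable fun x : HalfSpacePt m => ∫⁻ y, L₁ (x - y) * ‖f y‖ₑ :=
    Measurable.lintegral_prod_right' (f := fun p : HalfSpacePt m × HalfSpacePt m =>
      L₁ (p.1 - p.2) * ‖f p.2‖ₑ) (by fun_prop)
  have hT : Measurable fun x : HalfSpacePt m => ∫⁻ y, L₂ (x - y) * ‖g y‖ₑ :=
    Measurable.lintegral_prod_right' (f := fun p : HalfSpacePt m × HalfSpacePt m =>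
      L₂ (p.1 - p.2) * ‖g p.2‖ₑ) (by fun_prop)
  have hpt : ∀ x ∈ halfSpace m, ‖fderiv ℝ (neumannPotential m f) x (coordVec m k)‖ₑ ≤
      (∫⁻ y, L₁ (x - y) * ‖f y‖ₑ) + ∫⁻ y, L₂ (x - y) * ‖g y‖ₑ := fun x hx => by
    refine (enorm_fderiv_neumannPotential_le hθ hθc hθs k hx).trans ?_
    rw [← Set.Ioc_union_Ioi_eq_Ioi zero_le_one,
      lintegral_union measurableSet_Ioi (Set.Ioc_disjoint_Ioi le_rfl),
      ← lintegral_gaussAverage_mul m hc₁ hf.enorm, ← lintegral_gaussAverage_mul m hc₂ hg.enorm]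
    exact add_le_add
      (setLIntegral_mono' measurableSet_Ioc fun t ht => enorm_FheatD_le m k ht.1 f hx)
      (setLIntegral_mono' measurableSet_Ioi fun t ht =>
        enorm_FheatD_fderiv_le hθ hθc hθs k (zero_lt_one.trans (Set.mem_Ioi.1 ht)) hx)
  rw [eLpNorm_restrict_eq_of_support_subset hfs, eLpNorm_restrict_eq_of_support_subset hgs]
  calc _ ≤ eLpNorm (fun x => (∫⁻ y, L₁ (x - y) * ‖f y‖ₑ) + ∫⁻ y, L₂ (x - y) * ‖g y‖ₑ) q
        (volume.restrict (halfSpace m)) :=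
      eLpNorm_mono_enorm_ae <| by
        filter_upwards [ae_restrict_mem (measurableSet_halfSpace m)] with x hx
        exact hpt x hx
    _ ≤ eLpNorm (fun x => (∫⁻ y, L₁ (x - y) * ‖f y‖ₑ) + ∫⁻ y, L₂ (x - y) * ‖g y‖ₑ) q volume :=
      eLpNorm_mono_measure _ Measure.restrict_le_self
    _ ≤ eLpNorm (fun x => ∫⁻ y, L₁ (x - y) * ‖f y‖ₑ) q volume +
        eLpNorm (fun x => ∫⁻ y, L₂ (x - y) * ‖g y‖ₑ) q volume :=
      eLpNorm_add_le hS.aestronglyMeasurable hT.aestronglyMeasurable hq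
    _ ≤ (∫⁻ z, L₁ z) * eLpNorm f q volume + (∫⁻ z, L₂ z) * eLpNorm g q volume := by
      have h1 := eLpNorm_lintegral_sub_mul_le (μ := volume) hL₁ hf.enorm hq
      have h2 := eLpNorm_lintegral_sub_mul_le (μ := volume) hL₂ hg.enorm hq
      rw [eLpNorm_enorm] at h1 h2
      exact add_le_add h1 h2
    _ ≤ _ := by
      rw [mul_add]
      gcongr
      · rw [ENNReal.le_ofReal_iff_toReal_le hW₁ (by positivity)]
        linarith [ENNReal.toReal_nonneg (a := ∫⁻ z, L₂ z)]
      · rw [ENNReal.le_ofReal_iff_toReal_le hW₂ (by positivity)]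
        linarith [ENNReal.toReal_nonneg (a := ∫⁻ z, L₁ z)]

end
end

section
/- Let n ≥ 1, τ > 0, and θ ∈ C_c^∞(ℝⁿ₊) (smooth, compactly supported in the open half-space). Then for every x ∈ ℝⁿ, (G_τ * (∂ₙθ)_*)(x) = ∂_{xₙ}∂_{xₙ} ∫_{ℝⁿ} ∫₀¹ G_τ(x′−y′, xₙ−s·yₙ) · (−yₙ) · θ^*(y) ds dy, where * denotes convolution on ℝⁿ and the inner double integral converges absolutely. -/
open MeasureTheory ENNReal

noncomputable section

/-- The odd extension `f^*` of a function on the half-space to all of `ℝⁿ`. -/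
def oddExt (m : ℕ) (f : HalfSpacePt m → ℝ) (x : HalfSpacePt m) : ℝ :=
  if 0 ≤ x.2 then f x else -f (x.1, -x.2)

/-- The even extension `f_*` of a function on the half-space to all of `ℝⁿ`. -/
def evenExt (m : ℕ) (f : HalfSpacePt m → ℝ) (x : HalfSpacePt m) : ℝ :=
  if 0 ≤ x.2 then f x else f (x.1, -x.2)

/-- The part of the Gauss kernel depending on the tangential variables. -/
def gaussTan (m : ℕ) (t : ℝ) (z : Fin m → ℝ) : ℝ :=
  (4 * Real.pi * t) ^ (-((m : ℝ) + 1) / 2) * Real.exp (-(∑ i, z i ^ 2) / (4 * t))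

/-- The unnormalised one-dimensional Gaussian, the part of the Gauss kernel depending on `xₙ`. -/
def gaussNor (t u : ℝ) : ℝ := Real.exp (-u ^ 2 / (4 * t))

lemma gauss_eq_mul (m : ℕ) (t : ℝ) (a : Fin m → ℝ) (b : ℝ) :
    gauss m t (a, b) = gaussTan m t a * gaussNor t b := by
  simp only [gauss, gaussTan, gaussNor]
  rw [mul_assoc ((4 * Real.pi * t) ^ _), ← Real.exp_add]
  congr 2
  ring

lemma continuous_gaussTan (m : ℕ) (t : ℝ) : Continuous (gaussTan m t) := by
  unfold gaussTan
  fun_prop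

lemma hasDerivAt_gaussNor (t u : ℝ) :
    HasDerivAt (gaussNor t) (gaussNor t u * (-(2 * u) / (4 * t))) u := by
  unfold gaussNor
  simpa using (((hasDerivAt_id u).pow 2).neg.div_const (4 * t)).exp

lemma continuous_gaussNor (t : ℝ) : Continuous (gaussNor t) :=
  continuous_iff_continuousAt.2 fun u => (hasDerivAt_gaussNor t u).continuousAt

lemma norm_gaussNor_le_one {t : ℝ} (ht : 0 < t) (u : ℝ) : ‖gaussNor t u‖ ≤ 1 := by
  rw [gaussNor, Real.norm_eq_abs, Real.abs_exp, Real.exp_le_one_iff, neg_div]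
  have : 0 ≤ u ^ 2 / (4 * t) := by positivity
  linarith

/-- Reflection of `ℝⁿ` in the boundary hyperplane `xₙ = 0`. -/
def reflect (m : ℕ) : HalfSpacePt m ≃ₜ HalfSpacePt m :=
  (Homeomorph.refl _).prodCongr (Homeomorph.neg ℝ)

@[simp]
lemma reflect_apply (m : ℕ) (y : HalfSpacePt m) : reflect m y = (y.1, -y.2) := rfl

lemma measurePreserving_reflect (m : ℕ) :
    MeasurePreserving (reflect m) (volume : Measure (HalfSpacePt m)) volume :=
  (MeasurePreserving.id volume).prod (Measure.measurePreserving_neg volume)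

lemma apply_eq_zero_of_snd_nonpos {m : ℕ} {f : HalfSpacePt m → ℝ} (hf : tsupport f ⊆ halfSpace m)
    {y : HalfSpacePt m} (hy : y.2 ≤ 0) : f y = 0 :=
  image_eq_zero_of_notMem_tsupport fun h => hy.not_gt (hf h)

lemma oddExt_eq_sub {m : ℕ} {f : HalfSpacePt m → ℝ} (hf : tsupport f ⊆ halfSpace m) :
    oddExt m f = fun y => f y - f (reflect m y) := by
  funext y
  simp only [oddExt, reflect_apply]
  split_ifs with h
  · rw [apply_eq_zero_of_snd_nonpos hf (y := (y.1, -y.2)) (by simpa using h), sub_zero]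
  · rw [apply_eq_zero_of_snd_nonpos hf (not_le.1 h).le, zero_sub]

lemma evenExt_eq_add {m : ℕ} {f : HalfSpacePt m → ℝ} (hf : tsupport f ⊆ halfSpace m) :
    evenExt m f = fun y => f y + f (reflect m y) := by
  funext y
  simp only [evenExt, reflect_apply]
  split_ifs with h
  · rw [apply_eq_zero_of_snd_nonpos hf (y := (y.1, -y.2)) (by simpa using h), add_zero]
  · rw [apply_eq_zero_of_snd_nonpos hf (not_le.1 h).le, zero_add]

lemma continuous_oddExt {m : ℕ} {f : HalfSpacePt m → ℝ} (hf : Continuous f)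
    (hfs : tsupport f ⊆ halfSpace m) : Continuous (oddExt m f) := by
  rw [oddExt_eq_sub hfs]
  exact hf.sub (hf.comp (reflect m).continuous)

lemma hasCompactSupport_oddExt {m : ℕ} {f : HalfSpacePt m → ℝ} (hf : HasCompactSupport f)
    (hfs : tsupport f ⊆ halfSpace m) : HasCompactSupport (oddExt m f) := by
  rw [oddExt_eq_sub hfs]
  exact hf.sub (hf.comp_homeomorph (reflect m))

lemma continuous_evenExt {m : ℕ} {f : HalfSpacePt m → ℝ} (hf : Continuous f)
    (hfs : tsupport f ⊆ halfSpace m) : Continuous (evenExt m f) := by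
  rw [evenExt_eq_add hfs]
  exact hf.add (hf.comp (reflect m).continuous)

lemma hasCompactSupport_evenExt {m : ℕ} {f : HalfSpacePt m → ℝ} (hf : HasCompactSupport f)
    (hfs : tsupport f ⊆ halfSpace m) : HasCompactSupport (evenExt m f) := by
  rw [evenExt_eq_add hfs]
  exact hf.add (hf.comp_homeomorph (reflect m))

/-- The normal derivative of the odd extension is the even extension of the normal derivative. -/
lemma hasLineDerivAt_oddExt {m : ℕ} {f : HalfSpacePt m → ℝ} (hf : Differentiable ℝ f)
    (hfs : tsupport f ⊆ halfSpace m) (y : HalfSpacePt m) :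
    HasLineDerivAt ℝ (oddExt m f) (evenExt m (fun z => fderiv ℝ f z (0, 1)) y) y (0, 1) := by
  have hfs' : tsupport (fun z => fderiv ℝ f z (0, 1)) ⊆ halfSpace m :=
    (tsupport_fderiv_apply_subset ℝ _).trans hfs
  rw [oddExt_eq_sub hfs, evenExt_eq_add hfs']
  have h₁ := (hf y).hasFDerivAt.hasLineDerivAt (0, 1)
  have h₂ := (hf (reflect m y)).hasFDerivAt.hasLineDerivAt (-(0, 1))
  rw [map_neg] at h₂
  have h := HasDerivAt.sub h₁ h₂
  rw [sub_neg_eq_add] at h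
  refine h.congr_of_eventuallyEq (Filter.Eventually.of_forall fun t => ?_)
  simp [add_comm]

/-- A function of the tangential variables is orthogonal to odd extensions. -/
lemma integral_mul_oddExt_eq_zero {m : ℕ} {f : HalfSpacePt m → ℝ} (hf : Continuous f)
    (hfc : HasCompactSupport f) (hfs : tsupport f ⊆ halfSpace m) {c : (Fin m → ℝ) → ℝ}
    (hc : Continuous c) : ∫ y : HalfSpacePt m, c y.1 * oddExt m f y = 0 := by
  have hi : Integrable fun y : HalfSpacePt m => c y.1 * f y :=
    Continuous.integrable_of_hasCompactSupport (by fun_prop) hfc.mul_left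
  have hmp := measurePreserving_reflect m
  have hr : ∫ y : HalfSpacePt m, c y.1 * f (reflect m y) = ∫ y : HalfSpacePt m, c y.1 * f y :=
    hmp.integral_comp (reflect m).measurableEmbedding fun y => c y.1 * f y
  have hi' : Integrable fun y : HalfSpacePt m => c y.1 * f (reflect m y) :=
    hmp.integrable_comp_of_integrable hi
  simp only [oddExt_eq_sub hfs, mul_sub]
  rw [integral_sub hi hi', hr, sub_self]

/-- Differentiation under the integral sign for a convolution in the last variable against a
compactly supported continuous function. -/
lemma hasDerivAt_integral_comp_sub_mul {m : ℕ} {k k' : ℝ → ℝ} (hk : ∀ u, HasDerivAt k (k' u) u)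
    (hk' : Continuous k') {φ : HalfSpacePt m → ℝ} (hφ : Continuous φ)
    (hφc : HasCompactSupport φ) (w : ℝ) :
    HasDerivAt (fun w => ∫ y : HalfSpacePt m, k (w - y.2) * φ y)
      (∫ y : HalfSpacePt m, k' (w - y.2) * φ y) w := by
  have hkc : Continuous k := continuous_iff_continuousAt.2 fun u => (hk u).continuousAt
  obtain ⟨C, hC⟩ := ((isCompact_closedBall w 1).prod hφc.isCompact).exists_bound_of_continuousOn
    (f := fun p : ℝ × HalfSpacePt m => k' (p.1 - p.2.2)) (by fun_prop)
  refine (hasDerivAt_integral_of_dominated_loc_of_deriv_le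
    (F := fun w (y : HalfSpacePt m) => k (w - y.2) * φ y)
    (F' := fun w (y : HalfSpacePt m) => k' (w - y.2) * φ y)
    (bound := fun y => C * ‖φ y‖) (Metric.closedBall_mem_nhds w one_pos) ?_ ?_ ?_ ?_ ?_ ?_).2
  · exact Filter.Eventually.of_forall fun v =>
      Continuous.aestronglyMeasurable (by fun_prop)
  · exact Continuous.integrable_of_hasCompactSupport (by fun_prop) hφc.mul_left
  · exact Continuous.aestronglyMeasurable (by fun_prop)
  · refine Filter.Eventually.of_forall fun y v hv => ?_
    rw [norm_mul]
    by_cases hy : y ∈ tsupport φ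
    · exact mul_le_mul_of_nonneg_right (hC (v, y) ⟨hv, hy⟩) (norm_nonneg _)
    · simp [image_eq_zero_of_notMem_tsupport hy]
  · exact (hφ.integrable_of_hasCompactSupport hφc).norm.const_mul C
  · exact Filter.Eventually.of_forall fun y v _ =>
      ((hk (v - y.2)).comp_sub_const v y.2).mul_const (φ y)

/-- The fundamental theorem of calculus along the segment from `w` to `w - a`. -/
lemma setIntegral_comp_sub_mul {k k' : ℝ → ℝ} (hk : ∀ u, HasDerivAt k (k' u) u)
    (hk' : Continuous k') (w a : ℝ) :
    ∫ s in Set.Ioo (0 : ℝ) 1, k' (w - s * a) * (-a) = k (w - a) - k w := by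
  rw [← integral_Ioc_eq_integral_Ioo, ← intervalIntegral.integral_of_le zero_le_one,
    intervalIntegral.integral_eq_sub_of_hasDerivAt (f := fun s => k (w - s * a))]
  · simp
  · intro s _
    have h : HasDerivAt (fun s : ℝ => w - s * a) (-a) s := by
      simpa using ((hasDerivAt_id s).mul_const a).const_sub w
    exact (hk (w - s * a)).comp s h
  · exact Continuous.intervalIntegrable (by fun_prop) _ _

/-- for `τ > 0` and `θ ∈ C_c^∞(ℝⁿ₊)`, for every `x ∈ ℝⁿ`,
`(G_τ * (∂ₙθ)_*)(x) = ∂_{xₙ}∂_{xₙ} ∫_{ℝⁿ}∫₀¹ G_τ(x′−y′, xₙ−s·yₙ)(−yₙ)θ^*(y) ds dy`,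
the inner double integral converging absolutely. -/
theorem conv_evenExt_dn_eq (m : ℕ) (τ : ℝ) (hτ : 0 < τ) (θ : HalfSpacePt m → ℝ)
    (hθ : ContDiff ℝ (⊤ : ℕ∞) θ) (hθc : HasCompactSupport θ)
    (hθs : tsupport θ ⊆ halfSpace m) (x : HalfSpacePt m) :
    Integrable
      (fun p : HalfSpacePt m × ℝ =>
        gauss m τ (x.1 - p.1.1, x.2 - p.2 * p.1.2) * (-p.1.2) * oddExt m θ p.1)
      (volume.prod (volume.restrict (Set.Ioo (0 : ℝ) 1))) ∧
    (∫ y : HalfSpacePt m,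
        gauss m τ (x - y) * evenExt m (fun z => fderiv ℝ θ z (0, 1)) y) =
      deriv (deriv (fun w : ℝ =>
        ∫ y : HalfSpacePt m, ∫ s in Set.Ioo (0 : ℝ) 1,
          gauss m τ (x.1 - y.1, w - s * y.2) * (-y.2) * oddExt m θ y)) x.2 := by
  have hθ₀ : Continuous θ := hθ.continuous
  have hφ := continuous_oddExt hθ₀ hθs
  have hφc := hasCompactSupport_oddExt hθc hθs
  have hc := continuous_gaussTan m τ
  have hh := continuous_gaussNor τ
  constructor
  · have hb : Integrable fun y : HalfSpacePt m =>
        gaussTan m τ (x.1 - y.1) * (-y.2) * oddExt m θ y :=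
      Continuous.integrable_of_hasCompactSupport (by fun_prop) hφc.mul_left
    have hb' := hb.mul_prod
      (integrable_const (1 : ℝ) : Integrable _ (volume.restrict (Set.Ioo (0 : ℝ) 1)))
    simp only [gauss_eq_mul]
    refine hb'.mono (Continuous.aestronglyMeasurable (by fun_prop))
      (Filter.Eventually.of_forall fun p => ?_)
    have hle := norm_gaussNor_le_one hτ (x.2 - p.2 * p.1.2)
    calc _ = ‖gaussTan m τ (x.1 - p.1.1) * (-p.1.2) * oddExt m θ p.1‖ *
          ‖gaussNor τ (x.2 - p.2 * p.1.2)‖ := by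
          rw [← norm_mul]
          ring_nf
      _ ≤ _ := by
          rw [mul_one]
          exact mul_le_of_le_one_right (norm_nonneg _) hle
  · set H : ℝ → ℝ := fun w => ∫ u in (0 : ℝ)..w, gaussNor τ u
    have hH : ∀ u, HasDerivAt H (gaussNor τ u) u := fun u =>
      hh.integral_hasStrictDerivAt 0 u |>.hasDerivAt
    have hHc : Continuous H := continuous_iff_continuousAt.2 fun u => (hH u).continuousAt
    have hh' : Continuous fun u => gaussNor τ u * (-(2 * u) / (4 * τ)) := by fun_prop
    set φ : HalfSpacePt m → ℝ := fun y => gaussTan m τ (x.1 - y.1) * oddExt m θ y with hφ_def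
    have hψ : Continuous φ := by fun_prop
    have hψc : HasCompactSupport φ := hφc.mul_left
    have hinner : ∀ w, (∫ y : HalfSpacePt m, ∫ s in Set.Ioo (0 : ℝ) 1,
        gauss m τ (x.1 - y.1, w - s * y.2) * (-y.2) * oddExt m θ y) =
        ∫ y : HalfSpacePt m, H (w - y.2) * φ y := by
      intro w
      have hz : ∫ y, φ y = 0 := integral_mul_oddExt_eq_zero hθ₀ hθc hθs
        (c := fun z => gaussTan m τ (x.1 - z)) (by fun_prop)
      have hi : Integrable fun y : HalfSpacePt m => H (w - y.2) * φ y :=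
        Continuous.integrable_of_hasCompactSupport (by fun_prop) hψc.mul_left
      have hi' : Integrable fun y : HalfSpacePt m => H w * φ y :=
        (hψ.integrable_of_hasCompactSupport hψc).const_mul _
      calc _ = ∫ y : HalfSpacePt m, (H (w - y.2) * φ y - H w * φ y) := by
            refine integral_congr_ae (Filter.Eventually.of_forall fun y => ?_)
            simp only
            rw [← sub_mul, ← setIntegral_comp_sub_mul hH hh, ← integral_mul_const]
            simp only [gauss_eq_mul, hφ_def]
            congr 1
            funext s
            ring
        _ = _ := by
            rw [integral_sub hi hi', integral_const_mul, hz, mul_zero, sub_zero]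
    have hderiv : deriv (fun w : ℝ => ∫ y : HalfSpacePt m, ∫ s in Set.Ioo (0 : ℝ) 1,
        gauss m τ (x.1 - y.1, w - s * y.2) * (-y.2) * oddExt m θ y) =
        fun w => ∫ y : HalfSpacePt m, gaussNor τ (w - y.2) * φ y := by
      simp only [hinner]
      exact funext fun w => (hasDerivAt_integral_comp_sub_mul hH hh hψ hψc w).deriv
    rw [hderiv,
      (hasDerivAt_integral_comp_sub_mul (hasDerivAt_gaussNor τ) hh' hψ hψc x.2).deriv]
    have hdcont : Continuous fun z => fderiv ℝ θ z (0, 1) :=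
      (hθ.continuous_fderiv (by simp)).clm_apply continuous_const
    have hdsupp : tsupport (fun z => fderiv ℝ θ z (0, 1)) ⊆ halfSpace m :=
      (tsupport_fderiv_apply_subset ℝ _).trans hθs
    have hdc := continuous_evenExt hdcont hdsupp
    have hdcc := hasCompactSupport_evenExt (hθc.fderiv_apply ℝ (0, 1)) hdsupp
    have hg : ∀ y : HalfSpacePt m, gauss m τ (x - y) =
        gaussTan m τ (x.1 - y.1) * gaussNor τ (x.2 - y.2) := fun y => gauss_eq_mul m τ _ _
    simp only [hg]
    have : (volume : Measure (HalfSpacePt m)).IsAddHaarMeasure :=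
      Measure.prod.instIsAddHaarMeasure _ _
    have hibp := integral_bilinear_hasLineDerivAt_right_eq_neg_left_of_integrable
      (μ := (volume : Measure (HalfSpacePt m))) (v := ((0 : Fin m → ℝ), (1 : ℝ)))
      (B := ContinuousLinearMap.mul ℝ ℝ)
      (f := fun y => gaussTan m τ (x.1 - y.1) * gaussNor τ (x.2 - y.2))
      (f' := fun y => gaussTan m τ (x.1 - y.1) *
        -(gaussNor τ (x.2 - y.2) * (-(2 * (x.2 - y.2)) / (4 * τ))))
      (g := oddExt m θ) (g' := evenExt m fun z => fderiv ℝ θ z (0, 1))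
      (Continuous.integrable_of_hasCompactSupport (by fun_prop) hφc.mul_left)
      (Continuous.integrable_of_hasCompactSupport (by fun_prop) hdcc.mul_left)
      (Continuous.integrable_of_hasCompactSupport (by fun_prop) hφc.mul_left)
      (fun y _ => ?_)
      (fun y _ => hasLineDerivAt_oddExt (hθ.differentiable (by simp)) hθs y)
    · simp only [ContinuousLinearMap.mul_apply'] at hibp
      rw [hibp, ← integral_neg]
      congr 1
      funext y
      simp only [hφ_def]
      ring
    · have h : HasDerivAt (fun t : ℝ => x.2 - (y.2 + t)) (-1) 0 := by
        simpa using ((hasDerivAt_id (0 : ℝ)).const_add y.2).const_sub x.2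
      have h' := (HasDerivAt.comp (0 : ℝ) (hasDerivAt_gaussNor τ _) h).const_mul
        (gaussTan m τ (x.1 - y.1))
      simpa [HasLineDerivAt, Function.comp_def] using h'

end
end

section
/- Let n ≥ 1, 1 ≤ k ≤ n, and 0 ≤ η < 1. There exists a constant C = C(n, η) > 0 such that for every y ∈ ℝⁿ, ∫₀¹ ∫_{ℝ^{n−1}×(0,1)} xₙ^{−η} |∂_{x_k}G_τ(x − y)| dx dτ ≤ C. -/
open MeasureTheory ENNReal

noncomputable section

lemma lintegral_ofReal_exp_neg_mul_sq_sub {b : ℝ} (hb : 0 < b) (a : ℝ) :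
    ∫⁻ x : ℝ, ENNReal.ofReal (Real.exp (-b * (x - a) ^ 2)) =
      ENNReal.ofReal (√(Real.pi / b)) := by
  rw [lintegral_sub_right_eq_self (fun x : ℝ => ENNReal.ofReal (Real.exp (-b * x ^ 2))) a,
    ← ofReal_integral_eq_lintegral_ofReal (integrable_exp_neg_mul_sq hb)
      (.of_forall fun x => (Real.exp_pos _).le), integral_gaussian]

lemma lintegral_ofReal_exp_neg_mul_sum_sq_sub {ι : Type*} [Fintype ι] {b : ℝ} (hb : 0 < b)
    (a : ι → ℝ) :
    ∫⁻ x : ι → ℝ, ENNReal.ofReal (Real.exp (-b * ∑ i, (x i - a i) ^ 2)) =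
      ENNReal.ofReal (√(Real.pi / b) ^ Fintype.card ι) := by
  have hprod (x : ι → ℝ) :
      Real.exp (-b * ∑ i, x i ^ 2) = ∏ i, Real.exp (-b * x i ^ 2) := by
    rw [Finset.mul_sum, Real.exp_sum]
  have hint : Integrable fun x : ι → ℝ => ∏ i, Real.exp (-b * x i ^ 2) :=
    Integrable.fintype_prod (f := fun _ v => Real.exp (-b * v ^ 2))
      fun _ => integrable_exp_neg_mul_sq hb
  have hshift := lintegral_sub_right_eq_self (μ := volume)
    (fun x : ι → ℝ => ENNReal.ofReal (Real.exp (-b * ∑ i, x i ^ 2))) a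
  simp only [Pi.sub_apply] at hshift
  rw [hshift]
  simp_rw [hprod]
  rw [← ofReal_integral_eq_lintegral_ofReal hint
      (.of_forall fun x => Finset.prod_nonneg fun i _ => (Real.exp_pos _).le),
    integral_fintype_prod_volume_eq_pow (fun v : ℝ => Real.exp (-b * v ^ 2)), integral_gaussian]

lemma lintegral_Ioo_rpow_neg {η : ℝ} (hη : η < 1) {r : ℝ} (hr : 0 ≤ r) :
    ∫⁻ x in Set.Ioo 0 r, ENNReal.ofReal (x ^ (-η)) =
      ENNReal.ofReal (r ^ (1 - η) / (1 - η)) := by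
  have hint : IntegrableOn (fun x : ℝ => x ^ (-η)) (Set.Ioc 0 r) :=
    (intervalIntegrable_iff_integrableOn_Ioc_of_le hr).1
      (intervalIntegral.intervalIntegrable_rpow' (by linarith))
  rw [setLIntegral_congr Ioo_ae_eq_Ioc, ← ofReal_integral_eq_lintegral_ofReal hint
    ((ae_restrict_iff' measurableSet_Ioc).2 (.of_forall fun x hx => Real.rpow_nonneg hx.1.le _)),
    ← intervalIntegral.integral_of_le hr, integral_rpow (Or.inl (by linarith))]
  rw [Real.zero_rpow (by linarith), sub_zero, neg_add_eq_sub]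

/-- A weighted Gaussian integral, split at distance `√τ` from the singularity of the weight. -/
lemma lintegral_rpow_neg_mul_exp_le {η : ℝ} (hη0 : 0 ≤ η) (hη1 : η < 1) {τ : ℝ} (hτ : 0 < τ)
    (a : ℝ) :
    ∫⁻ x in Set.Ioo (0 : ℝ) 1,
        ENNReal.ofReal (x ^ (-η) * Real.exp (-(1 / (8 * τ)) * (x - a) ^ 2)) ≤
      ENNReal.ofReal ((1 / (1 - η) + √(8 * Real.pi)) * √τ ^ (1 - η)) := by
  have hs : 0 < √τ := Real.sqrt_pos.2 hτ
  have hb : 0 < 1 / (8 * τ) := by positivity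
  have hη : 0 < 1 - η := by linarith
  calc
    _ ≤ ∫⁻ x in Set.Ioo (0 : ℝ) 1,
          ((Set.Ioo 0 (√τ)).indicator (fun x => ENNReal.ofReal (x ^ (-η))) x +
            ENNReal.ofReal (√τ ^ (-η)) *
              ENNReal.ofReal (Real.exp (-(1 / (8 * τ)) * (x - a) ^ 2))) := by
        refine setLIntegral_mono' measurableSet_Ioo fun x hx => ?_
        by_cases hxs : x < √τ
        · rw [Set.indicator_of_mem (show x ∈ Set.Ioo 0 (√τ) from ⟨hx.1, hxs⟩)]
          refine le_trans (ENNReal.ofReal_le_ofReal ?_) le_self_add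
          refine mul_le_of_le_one_right (Real.rpow_nonneg hx.1.le _) (Real.exp_le_one_iff.2 ?_)
          have := mul_nonneg hb.le (sq_nonneg (x - a))
          linarith
        · refine le_trans ?_ le_add_self
          rw [← ENNReal.ofReal_mul (by positivity)]
          have hweight : x ^ (-η) ≤ √τ ^ (-η) :=
            Real.rpow_le_rpow_of_nonpos hs (not_lt.1 hxs) (by linarith)
          exact ENNReal.ofReal_le_ofReal (by gcongr)
    _ ≤ ∫⁻ x : ℝ,
          ((Set.Ioo 0 (√τ)).indicator (fun x => ENNReal.ofReal (x ^ (-η))) x +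
            ENNReal.ofReal (√τ ^ (-η)) *
              ENNReal.ofReal (Real.exp (-(1 / (8 * τ)) * (x - a) ^ 2))) :=
        setLIntegral_le_lintegral _ _
    _ = ENNReal.ofReal (√τ ^ (1 - η) / (1 - η)) +
          ENNReal.ofReal (√τ ^ (-η)) * ENNReal.ofReal (√(Real.pi / (1 / (8 * τ)))) := by
        rw [lintegral_add_right _ (by fun_prop), lintegral_indicator measurableSet_Ioo,
          lintegral_Ioo_rpow_neg hη1 hs.le, lintegral_const_mul _ (by fun_prop),
          lintegral_ofReal_exp_neg_mul_sq_sub hb]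
    _ = _ := by
        rw [← ENNReal.ofReal_mul (by positivity), ← ENNReal.ofReal_add (by positivity)
          (by positivity)]
        congr 1
        rw [show Real.pi / (1 / (8 * τ)) = 8 * Real.pi * τ by field_simp,
          Real.sqrt_mul (by positivity), sub_eq_neg_add, Real.rpow_add hs, Real.rpow_one]
        ring

lemma hasDerivAt_gauss_line_s11 (m : ℕ) (t : ℝ) (z v : HalfSpacePt m) :
    HasDerivAt (fun s : ℝ => gauss m t (z + s • v))
      (gauss m t z * (-(2 * (∑ i, z.1 i * v.1 i + z.2 * v.2)) / (4 * t))) 0 := by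
  have hcoord (p q : ℝ) : HasDerivAt (fun s : ℝ => (p + s * q) ^ 2) (2 * (p * q)) 0 := by
    have h := (((hasDerivAt_id (0 : ℝ)).mul_const q).const_add p).pow 2
    convert! h using 1
    simp
    ring
  have hsum := HasDerivAt.fun_sum (u := Finset.univ) fun i _ => hcoord (z.1 i) (v.1 i)
  have h := (((hsum.add (hcoord z.2 v.2)).neg.div_const (4 * t)).exp).const_mul
    ((4 * Real.pi * t) ^ (-((m : ℝ) + 1) / 2))
  convert! h using 1
  simp [gauss, ← Finset.mul_sum]
  ring

lemma differentiable_gauss (m : ℕ) (t : ℝ) : Differentiable ℝ (gauss m t) := by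
  unfold gauss
  fun_prop

lemma fderiv_gauss_apply (m : ℕ) (t : ℝ) (z v : HalfSpacePt m) :
    fderiv ℝ (gauss m t) z v =
      gauss m t z * (-(2 * (∑ i, z.1 i * v.1 i + z.2 * v.2)) / (4 * t)) := by
  rw [← (differentiable_gauss m t z).lineDeriv_eq_fderiv]
  exact (hasDerivAt_gauss_line_s11 m t z v).deriv

lemma sq_inner_coordVec_le (m : ℕ) (k : Fin (m + 1)) (z : HalfSpacePt m) :
    (∑ i, z.1 i * (coordVec m k).1 i + z.2 * (coordVec m k).2) ^ 2 ≤
      ∑ i, z.1 i ^ 2 + z.2 ^ 2 := by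
  unfold coordVec
  split_ifs with h
  · have := Finset.single_le_sum (f := fun i => z.1 i ^ 2) (fun i _ => sq_nonneg _)
      (Finset.mem_univ (⟨k, h⟩ : Fin m))
    simp [Pi.single_apply] at this ⊢
    nlinarith [sq_nonneg z.2]
  · simpa using Finset.sum_nonneg fun i _ => sq_nonneg (z.1 i)

/-- A linear factor is absorbed by halving the rate of decay of the Gaussian. -/
lemma abs_div_mul_exp_neg_le {τ a q : ℝ} (hτ : 0 < τ) (haq : a ^ 2 ≤ q) :
    |a| / (2 * τ) * Real.exp (-q / (4 * τ)) ≤ (√τ)⁻¹ * Real.exp (-(1 / (8 * τ)) * q) := by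
  have hlin : |a| / (2 * τ) ≤ (√τ)⁻¹ * (q / (8 * τ) + 1) := by
    obtain ⟨s, hs, rfl⟩ : ∃ s : ℝ, 0 < s ∧ τ = s ^ 2 :=
      ⟨√τ, Real.sqrt_pos.2 hτ, (Real.sq_sqrt hτ.le).symm⟩
    rw [← sq_abs] at haq
    rw [Real.sqrt_sq hs.le]
    field_simp
    nlinarith [sq_nonneg (|a| - 2 * s)]
  calc
    _ ≤ (√τ)⁻¹ * Real.exp (q / (8 * τ)) * Real.exp (-q / (4 * τ)) := by
        gcongr
        exact hlin.trans (by gcongr; exact Real.add_one_le_exp _)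
    _ = _ := by
        rw [mul_assoc, ← Real.exp_add]
        congr 2
        field_simp
        ring

lemma abs_fderiv_gauss_le (m : ℕ) (k : Fin (m + 1)) {τ : ℝ} (hτ : 0 < τ) (z : HalfSpacePt m) :
    |fderiv ℝ (gauss m τ) z (coordVec m k)| ≤
      (4 * Real.pi * τ) ^ (-((m : ℝ) + 1) / 2) * (√τ)⁻¹ *
        (Real.exp (-(1 / (8 * τ)) * ∑ i, z.1 i ^ 2) * Real.exp (-(1 / (8 * τ)) * z.2 ^ 2)) := by
  have h := abs_div_mul_exp_neg_le hτ (sq_inner_coordVec_le m k z)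
  have hc : 0 ≤ (4 * Real.pi * τ) ^ (-((m : ℝ) + 1) / 2) := by positivity
  rw [← Real.exp_add, ← mul_add, fderiv_gauss_apply, mul_assoc]
  refine le_trans (le_of_eq ?_) (mul_le_mul_of_nonneg_left h hc)
  rw [gauss, abs_mul, abs_mul, abs_of_nonneg hc, Real.abs_exp, abs_div, abs_neg, abs_mul,
    abs_of_pos (show 0 < 4 * τ by positivity), abs_two]
  field_simp
  ring

lemma lintegral_slab_gauss_deriv_le (m : ℕ) (k : Fin (m + 1)) {η : ℝ} (hη0 : 0 ≤ η)
    (hη1 : η < 1) {τ : ℝ} (hτ : 0 < τ) (y : HalfSpacePt m) :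
    ∫⁻ x in (Set.univ ×ˢ Set.Ioo (0 : ℝ) 1 : Set (HalfSpacePt m)),
        ENNReal.ofReal (x.2 ^ (-η) * |fderiv ℝ (gauss m τ) (x - y) (coordVec m k)|) ≤
      ENNReal.ofReal ((4 * Real.pi) ^ (-((m : ℝ) + 1) / 2) * √(8 * Real.pi) ^ m *
        (1 / (1 - η) + √(8 * Real.pi)) * τ ^ (-(1 + η) / 2)) := by
  have hb : 0 < 1 / (8 * τ) := by positivity
  have hη : 0 < 1 - η := by linarith
  have hmeas : (volume : Measure (HalfSpacePt m)).restrict (Set.univ ×ˢ Set.Ioo (0 : ℝ) 1) =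
      (volume : Measure (Fin m → ℝ)).prod (volume.restrict (Set.Ioo (0 : ℝ) 1)) := by
    rw [Measure.volume_eq_prod, ← Measure.prod_restrict, Measure.restrict_univ]
  set D : ℝ := (4 * Real.pi * τ) ^ (-((m : ℝ) + 1) / 2) * (√τ)⁻¹ with hD
  have hD0 : 0 ≤ D := by positivity
  calc
    _ ≤ ∫⁻ x in (Set.univ ×ˢ Set.Ioo (0 : ℝ) 1 : Set (HalfSpacePt m)),
          ENNReal.ofReal D *
            (ENNReal.ofReal (Real.exp (-(1 / (8 * τ)) * ∑ i, (x.1 i - y.1 i) ^ 2)) *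
              ENNReal.ofReal
                (x.2 ^ (-η) * Real.exp (-(1 / (8 * τ)) * (x.2 - y.2) ^ 2))) := by
        refine setLIntegral_mono' (MeasurableSet.univ.prod measurableSet_Ioo) fun x hx => ?_
        have hx0 : 0 ≤ x.2 ^ (-η) := Real.rpow_nonneg hx.2.1.le _
        rw [← ENNReal.ofReal_mul (by positivity), ← ENNReal.ofReal_mul hD0]
        refine ENNReal.ofReal_le_ofReal ?_
        refine (mul_le_mul_of_nonneg_left (abs_fderiv_gauss_le m k hτ (x - y)) hx0).trans_eq ?_
        simp only [Prod.fst_sub, Prod.snd_sub, Pi.sub_apply, ← hD]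
        ring
    _ = ENNReal.ofReal D *
          (ENNReal.ofReal (√(Real.pi / (1 / (8 * τ))) ^ m) *
            ∫⁻ x in Set.Ioo (0 : ℝ) 1,
              ENNReal.ofReal (x ^ (-η) * Real.exp (-(1 / (8 * τ)) * (x - y.2) ^ 2))) := by
        rw [lintegral_const_mul _ (by fun_prop), hmeas,
          lintegral_prod_mul
            (f := fun x : Fin m → ℝ =>
              ENNReal.ofReal (Real.exp (-(1 / (8 * τ)) * ∑ i, (x i - y.1 i) ^ 2)))
            (g := fun x : ℝ =>
              ENNReal.ofReal (x ^ (-η) * Real.exp (-(1 / (8 * τ)) * (x - y.2) ^ 2)))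
            (Measurable.aemeasurable (by fun_prop)) (Measurable.aemeasurable (by fun_prop)),
          lintegral_ofReal_exp_neg_mul_sum_sq_sub hb, Fintype.card_fin]
    _ ≤ ENNReal.ofReal D *
          (ENNReal.ofReal (√(Real.pi / (1 / (8 * τ))) ^ m) *
            ENNReal.ofReal ((1 / (1 - η) + √(8 * Real.pi)) * √τ ^ (1 - η))) := by
        gcongr
        exact lintegral_rpow_neg_mul_exp_le hη0 hη1 hτ y.2
    _ = _ := by
        rw [← ENNReal.ofReal_mul (by positivity), ← ENNReal.ofReal_mul hD0]
        congr 1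
        have hpow : τ ^ (-((m : ℝ) + 1) / 2) * (√τ)⁻¹ * √τ ^ m * √τ ^ (1 - η) =
            τ ^ (-(1 + η) / 2) := by
          rw [Real.sqrt_eq_rpow, ← Real.rpow_neg hτ.le, ← Real.rpow_natCast,
            ← Real.rpow_mul hτ.le, ← Real.rpow_mul hτ.le, ← Real.rpow_add hτ,
            ← Real.rpow_add hτ, ← Real.rpow_add hτ]
          congr 1
          ring
        rw [hD, show Real.pi / (1 / (8 * τ)) = 8 * Real.pi * τ by field_simp,
          Real.sqrt_mul (by positivity), mul_pow, Real.mul_rpow (by positivity) hτ.le, ← hpow]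
        ring

/-- for `1 ≤ k ≤ n` and `0 ≤ η < 1` there is `C = C(n,η) > 0` such that
for every `y ∈ ℝⁿ`,
`∫₀¹ ∫_{ℝ^{n−1}×(0,1)} xₙ^{−η} |∂_{x_k}G_τ(x − y)| dx dτ ≤ C` (`n = m + 1`). -/
theorem gauss_deriv_weighted_slab_bound (m : ℕ) (k : Fin (m + 1)) (η : ℝ)
    (hη0 : 0 ≤ η) (hη1 : η < 1) :
    ∃ C : ℝ, 0 < C ∧ ∀ y : HalfSpacePt m,
      (∫⁻ τ in Set.Ioo (0 : ℝ) 1,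
        ∫⁻ x in (Set.univ ×ˢ Set.Ioo (0 : ℝ) 1 : Set (HalfSpacePt m)),
          ENNReal.ofReal (x.2 ^ (-η) * |fderiv ℝ (gauss m τ) (x - y) (coordVec m k)|)) ≤
        ENNReal.ofReal C := by
  set K : ℝ := (4 * Real.pi) ^ (-((m : ℝ) + 1) / 2) * √(8 * Real.pi) ^ m *
    (1 / (1 - η) + √(8 * Real.pi))
  have hint : IntegrableOn (fun τ : ℝ => K * τ ^ (-(1 + η) / 2)) (Set.Ioo 0 1) :=
    (((intervalIntegrable_iff_integrableOn_Ioo_of_le zero_le_one).1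
      (intervalIntegral.intervalIntegrable_rpow' (by linarith))).const_mul K)
  have hfin : ∫⁻ τ in Set.Ioo (0 : ℝ) 1, ENNReal.ofReal (K * τ ^ (-(1 + η) / 2)) ≠ ⊤ :=
    hint.lintegral_lt_top.ne
  refine ⟨(∫⁻ τ in Set.Ioo (0 : ℝ) 1,
    ENNReal.ofReal (K * τ ^ (-(1 + η) / 2))).toReal + 1, by positivity, fun y => ?_⟩
  refine (setLIntegral_mono' measurableSet_Ioo fun τ hτ =>
    lintegral_slab_gauss_deriv_le m k hη0 hη1 hτ.1 y).trans ?_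
  exact (ENNReal.ofReal_toReal hfin).ge.trans (ENNReal.ofReal_le_ofReal (by linarith))

end
end

section
/- Let n ≥ 1, 1 ≤ k ≤ n, and 0 ≤ η < 1. There exists a constant C = C(n, η) > 0 such that for every y = (y′, yₙ) ∈ ℝⁿ, ∫₀¹ ∫₁^∞ ∫_{ℝ^{n−1}×(0,1)} xₙ^{−η} |∂_{x_k}∂_{xₙ}∂_{xₙ}G_τ(x′−y′, xₙ−s·yₙ)| dx dτ ds ≤ C. -/
open MeasureTheory ENNReal

noncomputable section

section GaussianOfBilinearForm

variable {E : Type*} [NormedAddCommGroup E] [NormedSpace ℝ E]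
  (B : E →L[ℝ] E →L[ℝ] ℝ) (A α : ℝ)

lemma hasFDerivAt_exp_bilin (hB : ∀ u v, B u v = B v u) (z : E) :
    HasFDerivAt (fun z => A * Real.exp (α / 2 * B z z))
      ((α * (A * Real.exp (α / 2 * B z z))) • B z) z := by
  have h1 : HasFDerivAt (fun z => B z z) ((B z).comp (ContinuousLinearMap.id ℝ E) + B.flip z) z :=
    B.hasFDerivAt.clm_apply (hasFDerivAt_id z)
  refine (((h1.const_mul (α / 2)).exp).const_mul A).congr_fderiv
    (ContinuousLinearMap.ext fun w => ?_)
  simp [hB w z]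
  ring

lemma contDiff_exp_bilin : ContDiff ℝ 3 (fun z => A * Real.exp (α / 2 * B z z)) := by
  have : ContDiff ℝ 3 (fun z => B z z) := B.contDiff.clm_apply contDiff_id
  fun_prop

lemma fderiv_three_exp_bilin (hB : ∀ u v, B u v = B v u) (z c a b : E) :
    fderiv ℝ (fderiv ℝ (fderiv ℝ (fun z => A * Real.exp (α / 2 * B z z)))) z c a b =
      A * Real.exp (α / 2 * B z z) * (α ^ 3 * (B z c * B z a * B z b) +
        α ^ 2 * (B c a * B z b + B z a * B c b + B z c * B a b)) := by
  set G : E → ℝ := fun z => A * Real.exp (α / 2 * B z z) with hG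
  have hG1 : ∀ z, HasFDerivAt G ((α * G z) • B z) z := hasFDerivAt_exp_bilin B A α hB
  have hBv : ∀ z v, HasFDerivAt (fun z => B z v) (B.flip v) z := fun z v =>
    (B.flip v).hasFDerivAt
  have hC : ContDiff ℝ 3 G := contDiff_exp_bilin B A α
  have hC1 : ContDiff ℝ 2 (fderiv ℝ G) := hC.fderiv_right (by norm_num)
  have hC2 : ContDiff ℝ 1 (fderiv ℝ (fderiv ℝ G)) := hC1.fderiv_right (by norm_num)
  have e1 : ∀ z, fderiv ℝ G z b = α * (G z * B z b) := fun z => by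
    rw [(hG1 z).fderiv]; simp [mul_assoc]
  have e2 : ∀ z, fderiv ℝ (fderiv ℝ G) z a b
      = α * (G z * (B a b) + B z b * (α * G z * B z a)) := fun z => by
    have hd := ((hC1.differentiable (by norm_num)) z).hasFDerivAt.clm_apply
      (hasFDerivAt_const b z)
    have hd' := (((hG1 z).mul (hBv z b)).const_mul α)
    have := congrArg (fun L => L a) (hd.unique (hd'.congr_of_eventuallyEq
      (Filter.Eventually.of_forall e1)))
    simpa [mul_add] using this
  have hd := (((hC2.differentiable (by norm_num)) z).hasFDerivAt.clm_apply
    (hasFDerivAt_const a z)).clm_apply (hasFDerivAt_const b z)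
  have hd' := ((((hG1 z).mul_const (B a b)).add
    ((hBv z b).mul (((hG1 z).const_mul α).mul (hBv z a)))).const_mul α)
  have := congrArg (fun L => L c) (hd.unique (hd'.congr_of_eventuallyEq
      (Filter.Eventually.of_forall e2)))
  simp at this
  rw [this]
  ring

end GaussianOfBilinearForm

/-- The Euclidean inner product on `HalfSpacePt m`, as a continuous bilinear form. -/
def euclideanForm (m : ℕ) : HalfSpacePt m →L[ℝ] HalfSpacePt m →L[ℝ] ℝ :=
  (∑ i, ((ContinuousLinearMap.proj (R := ℝ) (φ := fun _ : Fin m => ℝ) i).comp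
      (ContinuousLinearMap.fst ℝ (Fin m → ℝ) ℝ)).smulRight
    ((ContinuousLinearMap.proj (R := ℝ) (φ := fun _ : Fin m => ℝ) i).comp
      (ContinuousLinearMap.fst ℝ (Fin m → ℝ) ℝ))) +
  (ContinuousLinearMap.snd ℝ (Fin m → ℝ) ℝ).smulRight (ContinuousLinearMap.snd ℝ (Fin m → ℝ) ℝ)

lemma euclideanForm_apply (m : ℕ) (u v : HalfSpacePt m) :
    euclideanForm m u v = (∑ i, u.1 i * v.1 i) + u.2 * v.2 := by
  simp [euclideanForm]

lemma euclideanForm_comm (m : ℕ) (u v : HalfSpacePt m) :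
    euclideanForm m u v = euclideanForm m v u := by
  simp [euclideanForm_apply, mul_comm]

lemma euclideanForm_sq_le (m : ℕ) (u v : HalfSpacePt m) :
    euclideanForm m u v ^ 2 ≤ euclideanForm m u u * euclideanForm m v v := by
  have h := Finset.sum_mul_sq_le_sq_mul_sq (Finset.univ : Finset (Option (Fin m)))
    (fun o => o.elim u.2 u.1) (fun o => o.elim v.2 v.1)
  simp only [Fintype.sum_option, Option.elim] at h
  simp only [euclideanForm_apply, ← sq]
  nlinarith [h]

lemma euclideanForm_self_nonneg (m : ℕ) (u : HalfSpacePt m) : 0 ≤ euclideanForm m u u := by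
  rw [euclideanForm_apply]
  exact add_nonneg (Finset.sum_nonneg fun i _ => mul_self_nonneg _) (mul_self_nonneg _)

lemma euclideanForm_coordVec (m : ℕ) (k : Fin (m + 1)) :
    euclideanForm m (coordVec m k) (coordVec m k) = 1 := by
  unfold coordVec
  split_ifs with h
  · simp [euclideanForm_apply, Pi.single_apply]
  · simp [euclideanForm_apply]

lemma cubic_mul_exp_neg_le (r : ℝ) :
    Real.exp (-(r ^ 2 / 4)) * (r ^ 3 / 8 + 3 * r / 4) ≤ 16 * Real.exp (-(r ^ 2 / 8)) := by
  have h1 := Real.quadratic_le_exp_of_nonneg (x := r ^ 2 / 8) (by positivity)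
  have h2 : r ^ 3 / 8 + 3 * r / 4 ≤ 16 * Real.exp (r ^ 2 / 8) := by
    nlinarith [sq_nonneg (r - 1), sq_nonneg (r ^ 2 - r), sq_nonneg r, sq_nonneg (r ^ 2)]
  calc _ ≤ Real.exp (-(r ^ 2 / 4)) * (16 * Real.exp (r ^ 2 / 8)) := by gcongr
    _ = 16 * Real.exp (-(r ^ 2 / 4) + r ^ 2 / 8) := by rw [Real.exp_add]; ring
    _ = _ := by ring_nf

lemma gauss_eq_exp_euclideanForm (m : ℕ) (t : ℝ) :
    gauss m t = fun z => (4 * Real.pi * t) ^ (-((m : ℝ) + 1) / 2) *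
      Real.exp (-(1 / (2 * t)) / 2 * euclideanForm m z z) := by
  funext z
  simp only [gauss, euclideanForm_apply, sq]
  congr 2
  ring

lemma abs_le_of_cubic_terms {w r p q b : ℝ} (hw : 0 < w) (hp : |p| ≤ r * w)
    (hq : |q| ≤ r * w) (hb : |b| ≤ 1) :
    |(-(1 / (2 * w ^ 2))) ^ 3 * (p * q * q) +
        (-(1 / (2 * w ^ 2))) ^ 2 * (b * q + q * b + p * 1)| ≤
      (r ^ 3 / 8 + 3 * r / 4) / w ^ 3 := by
  have hrw : 0 ≤ r * w := (abs_nonneg p).trans hp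
  have h1 : |p * q * q| ≤ (r * w) * (r * w) * (r * w) := by
    rw [abs_mul, abs_mul]; gcongr
  have h3 : |b * q| ≤ 1 * (r * w) := by
    rw [abs_mul]; gcongr
  have h2 : |b * q + q * b + p * 1| ≤ 3 * (r * w) := by
    rw [abs_le] at *
    constructor <;> linarith
  calc _ ≤ |(-(1 / (2 * w ^ 2))) ^ 3 * (p * q * q)| +
        |(-(1 / (2 * w ^ 2))) ^ 2 * (b * q + q * b + p * 1)| := abs_add_le _ _
    _ = (1 / (2 * w ^ 2)) ^ 3 * |p * q * q| +
        (1 / (2 * w ^ 2)) ^ 2 * |b * q + q * b + p * 1| := by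
      have : |1 / (2 * w ^ 2)| = 1 / (2 * w ^ 2) := abs_of_nonneg (by positivity)
      rw [abs_mul _ (p * q * q), abs_mul _ (b * q + q * b + p * 1), abs_pow, abs_pow, abs_neg, this]
    _ ≤ (1 / (2 * w ^ 2)) ^ 3 * ((r * w) * (r * w) * (r * w)) +
        (1 / (2 * w ^ 2)) ^ 2 * (3 * (r * w)) := by gcongr
    _ = _ := by field_simp; ring

lemma abs_fderiv_three_gauss_le (m : ℕ) (k : Fin (m + 1)) {t : ℝ} (ht : 0 < t)
    (z : HalfSpacePt m) :
    |fderiv ℝ (fderiv ℝ (fderiv ℝ (gauss m t))) z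
      (coordVec m k) ((0 : Fin m → ℝ), (1 : ℝ)) ((0 : Fin m → ℝ), (1 : ℝ))| ≤
      16 * ((4 * Real.pi * t) ^ (-((m : ℝ) + 1) / 2) / Real.sqrt t ^ 3) *
        ∏ i, Real.exp (-(1 / (8 * t)) * z.1 i ^ 2) := by
  have hn : euclideanForm m ((0 : Fin m → ℝ), (1 : ℝ)) ((0 : Fin m → ℝ), (1 : ℝ)) = 1 := by
    simp [euclideanForm_apply]
  rw [gauss_eq_exp_euclideanForm, fderiv_three_exp_bilin _ _ _ (euclideanForm_comm m), hn]
  set n : HalfSpacePt m := ((0 : Fin m → ℝ), (1 : ℝ))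
  set A := (4 * Real.pi * t) ^ (-((m : ℝ) + 1) / 2)
  have hA : 0 ≤ A := by positivity
  set Q := euclideanForm m z z with hQ
  have hQ0 : 0 ≤ Q := euclideanForm_self_nonneg m z
  obtain ⟨w, hw, rfl⟩ : ∃ w : ℝ, 0 < w ∧ w ^ 2 = t :=
    ⟨Real.sqrt t, Real.sqrt_pos.2 ht, Real.sq_sqrt ht.le⟩
  rw [Real.sqrt_sq hw.le]
  obtain ⟨r, hr, hrQ⟩ : ∃ r : ℝ, 0 ≤ r ∧ (r * w) ^ 2 = Q :=
    ⟨Real.sqrt Q / w, by positivity, by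
      rw [div_mul_cancel₀ _ hw.ne', Real.sq_sqrt hQ0]⟩
  have hrw : 0 ≤ r * w := by positivity
  have hp : |euclideanForm m z (coordVec m k)| ≤ r * w := by
    apply abs_le_of_sq_le_sq _ hrw
    simpa [euclideanForm_coordVec, ← hQ, hrQ] using euclideanForm_sq_le m z (coordVec m k)
  have hq : |euclideanForm m z n| ≤ r * w := by
    apply abs_le_of_sq_le_sq _ hrw
    simpa [hn, ← hQ, hrQ] using euclideanForm_sq_le m z n
  have hb : |euclideanForm m (coordVec m k) n| ≤ 1 := by
    apply abs_le_of_sq_le_sq _ zero_le_one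
    simpa [hn, euclideanForm_coordVec] using euclideanForm_sq_le m (coordVec m k) n
  have hmain := abs_le_of_cubic_terms hw hp hq hb
  have hE : -(1 / (2 * w ^ 2)) / 2 * Q = -(r ^ 2 / 4) := by
    rw [← hrQ]; field_simp; ring
  have hsum : Real.exp (-(r ^ 2 / 8)) ≤ ∏ i, Real.exp (-(1 / (8 * w ^ 2)) * z.1 i ^ 2) := by
    rw [← Real.exp_sum, ← Finset.mul_sum]
    apply Real.exp_le_exp.2
    have h1 : ∑ i, z.1 i ^ 2 ≤ Q := by
      simp only [hQ, euclideanForm_apply, ← sq]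
      nlinarith [sq_nonneg z.2]
    have h2 : -(r ^ 2 / 8) = -(1 / (8 * w ^ 2)) * Q := by
      rw [← hrQ]; field_simp
    rw [h2]
    exact mul_le_mul_of_nonpos_left h1 (by simp only [Left.neg_nonpos_iff]; positivity)
  rw [hE, abs_mul, abs_of_nonneg (by positivity : 0 ≤ A * Real.exp (-(r ^ 2 / 4)))]
  calc _ ≤ A * Real.exp (-(r ^ 2 / 4)) * ((r ^ 3 / 8 + 3 * r / 4) / w ^ 3) := by gcongr
    _ = A / w ^ 3 * (Real.exp (-(r ^ 2 / 4)) * (r ^ 3 / 8 + 3 * r / 4)) := by ring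
    _ ≤ A / w ^ 3 * (16 * Real.exp (-(r ^ 2 / 8))) := by
      gcongr ?_ * ?_
      exact cubic_mul_exp_neg_le r
    _ ≤ A / w ^ 3 * (16 * ∏ i, Real.exp (-(1 / (8 * w ^ 2)) * z.1 i ^ 2)) := by gcongr
    _ = _ := by ring

lemma lintegral_prod_exp_neg_mul_sq (m : ℕ) {b : ℝ} (hb : 0 < b) (c : Fin m → ℝ) :
    ∫⁻ x : Fin m → ℝ, ENNReal.ofReal (∏ i, Real.exp (-b * (x - c) i ^ 2)) =
      ENNReal.ofReal (Real.sqrt (Real.pi / b) ^ m) := by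
  rw [lintegral_sub_right_eq_self
    (fun x : Fin m → ℝ => ENNReal.ofReal (∏ i, Real.exp (-b * x i ^ 2))) c]
  rw [← ofReal_integral_eq_lintegral_ofReal]
  · rw [integral_fintype_prod_volume_eq_pow (fun x : ℝ => Real.exp (-b * x ^ 2)),
      integral_gaussian, Fintype.card_fin]
  · exact Integrable.fintype_prod (fun _ => integrable_exp_neg_mul_sq hb)
  · exact Filter.Eventually.of_forall fun x => Finset.prod_nonneg fun i _ => (Real.exp_pos _).le

lemma gauss_scaling_factor (m : ℕ) {t : ℝ} (ht : 0 < t) :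
    (4 * Real.pi * t) ^ (-((m : ℝ) + 1) / 2) / Real.sqrt t ^ 3 *
      Real.sqrt (Real.pi / (1 / (8 * t))) ^ m =
    (4 * Real.pi) ^ (-((m : ℝ) + 1) / 2) * Real.sqrt (8 * Real.pi) ^ m * t ^ (-2 : ℝ) := by
  have h1 : Real.pi / (1 / (8 * t)) = 8 * Real.pi * t := by field_simp
  have hpi := Real.pi_pos
  rw [h1, Real.mul_rpow (by positivity) ht.le, Real.sqrt_mul (by positivity), mul_pow]
  have h2 : t ^ (-((m : ℝ) + 1) / 2) / Real.sqrt t ^ 3 * Real.sqrt t ^ m = t ^ (-2 : ℝ) := by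
    rw [Real.sqrt_eq_rpow, ← Real.rpow_natCast, ← Real.rpow_natCast, ← Real.rpow_mul ht.le,
      ← Real.rpow_mul ht.le, ← Real.rpow_sub ht, ← Real.rpow_add ht]
    congr 1
    push_cast
    ring
  rw [← h2]
  ring

lemma lintegral_slab_fderiv_three_gauss_le (m : ℕ) (k : Fin (m + 1)) (η : ℝ)
    {t : ℝ} (ht : 0 < t) (c : Fin m → ℝ) (d : ℝ) :
    ∫⁻ x in (Set.univ ×ˢ Set.Ioo (0 : ℝ) 1 : Set (HalfSpacePt m)),
      ENNReal.ofReal (x.2 ^ (-η) *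
        |fderiv ℝ (fderiv ℝ (fderiv ℝ (gauss m t))) (x.1 - c, x.2 - d)
          (coordVec m k) ((0 : Fin m → ℝ), (1 : ℝ)) ((0 : Fin m → ℝ), (1 : ℝ))|) ≤
      ENNReal.ofReal
          (16 * ((4 * Real.pi) ^ (-((m : ℝ) + 1) / 2) * Real.sqrt (8 * Real.pi) ^ m)) *
        (∫⁻ u in Set.Ioo (0 : ℝ) 1, ENNReal.ofReal (u ^ (-η))) *
        ENNReal.ofReal (t ^ (-2 : ℝ)) := by
  have hpi := Real.pi_pos
  set A := 16 * ((4 * Real.pi * t) ^ (-((m : ℝ) + 1) / 2) / Real.sqrt t ^ 3) with hA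
  have hA0 : 0 ≤ A := by positivity
  calc _ ≤ ∫⁻ x in (Set.univ ×ˢ Set.Ioo (0 : ℝ) 1 : Set (HalfSpacePt m)),
        ENNReal.ofReal A *
          (ENNReal.ofReal (∏ i, Real.exp (-(1 / (8 * t)) * (x.1 - c) i ^ 2)) *
            ENNReal.ofReal (x.2 ^ (-η))) := by
        apply setLIntegral_mono' (MeasurableSet.univ.prod measurableSet_Ioo)
        intro x hx
        have hx0 : 0 ≤ x.2 ^ (-η) := Real.rpow_nonneg hx.2.1.le _
        have hP : 0 ≤ ∏ i, Real.exp (-(1 / (8 * t)) * (x.1 - c) i ^ 2) :=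
          Finset.prod_nonneg fun i _ => (Real.exp_pos _).le
        rw [← ENNReal.ofReal_mul hP, ← ENNReal.ofReal_mul hA0]
        apply ENNReal.ofReal_le_ofReal
        calc _ ≤ x.2 ^ (-η) * (A * ∏ i, Real.exp (-(1 / (8 * t)) * (x.1 - c) i ^ 2)) := by
              gcongr
              exact abs_fderiv_three_gauss_le m k ht (x.1 - c, x.2 - d)
          _ = _ := by ring
    _ = ENNReal.ofReal A * (ENNReal.ofReal (Real.sqrt (Real.pi / (1 / (8 * t))) ^ m) *
          ∫⁻ u in Set.Ioo (0 : ℝ) 1, ENNReal.ofReal (u ^ (-η))) := by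
        rw [lintegral_const_mul' _ _ ENNReal.ofReal_ne_top, Measure.volume_eq_prod,
          ← Measure.prod_restrict, Measure.restrict_univ, lintegral_prod_mul
            (f := fun u : Fin m → ℝ =>
              ENNReal.ofReal (∏ i, Real.exp (-(1 / (8 * t)) * (u - c) i ^ 2)))
            (g := fun u : ℝ => ENNReal.ofReal (u ^ (-η))),
          lintegral_prod_exp_neg_mul_sq m (by positivity)]
        · fun_prop
        · fun_prop
    _ = _ := by
        rw [mul_right_comm, ← ENNReal.ofReal_mul (by positivity), ← mul_assoc,
          ← ENNReal.ofReal_mul hA0, hA, mul_assoc 16, mul_assoc 16, gauss_scaling_factor m ht]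

/-- for `1 ≤ k ≤ n` and `0 ≤ η < 1` there is `C = C(n,η) > 0` such that
for every `y = (y′, yₙ) ∈ ℝⁿ`,
`∫₀¹ ∫₁^∞ ∫_{ℝ^{n−1}×(0,1)} xₙ^{−η} |∂_{x_k}∂_{xₙ}∂_{xₙ}G_τ(x′−y′, xₙ−s·yₙ)| dx dτ ds ≤ C`
(`n = m + 1`). -/
theorem gauss_thirdDeriv_weighted_slab_bound (m : ℕ) (k : Fin (m + 1)) (η : ℝ)
    (hη0 : 0 ≤ η) (hη1 : η < 1) :
    ∃ C : ℝ, 0 < C ∧ ∀ y : HalfSpacePt m,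
      (∫⁻ s in Set.Ioo (0 : ℝ) 1, ∫⁻ τ in Set.Ioi (1 : ℝ),
        ∫⁻ x in (Set.univ ×ˢ Set.Ioo (0 : ℝ) 1 : Set (HalfSpacePt m)),
          ENNReal.ofReal (x.2 ^ (-η) *
            |fderiv ℝ (fderiv ℝ (fderiv ℝ (gauss m τ))) (x.1 - y.1, x.2 - s * y.2)
              (coordVec m k) ((0 : Fin m → ℝ), (1 : ℝ)) ((0 : Fin m → ℝ), (1 : ℝ))|)) ≤
        ENNReal.ofReal C := by
  set K := ENNReal.ofReal
    (16 * ((4 * Real.pi) ^ (-((m : ℝ) + 1) / 2) * Real.sqrt (8 * Real.pi) ^ m)) *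
      (∫⁻ u in Set.Ioo (0 : ℝ) 1, ENNReal.ofReal (u ^ (-η))) with hK
  have hKtop : K ≠ ⊤ := ENNReal.mul_ne_top ENNReal.ofReal_ne_top
    ((intervalIntegral.integrableOn_Ioo_rpow_iff zero_lt_one).2 (by linarith)).lintegral_lt_top.ne
  have hT : ∫⁻ τ in Set.Ioi (1 : ℝ), ENNReal.ofReal (τ ^ (-2 : ℝ)) ≠ ⊤ :=
    (integrableOn_Ioi_rpow_of_lt (by norm_num) zero_lt_one).lintegral_lt_top.ne
  set T := ∫⁻ τ in Set.Ioi (1 : ℝ), ENNReal.ofReal (τ ^ (-2 : ℝ))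
  refine ⟨(K * T).toReal + 1, by positivity, fun y => ?_⟩
  calc _ ≤ ∫⁻ _ in Set.Ioo (0 : ℝ) 1, K * T := by
        refine lintegral_mono fun s => ?_
        rw [← lintegral_const_mul' _ _ hKtop]
        exact setLIntegral_mono' measurableSet_Ioi fun τ hτ =>
          lintegral_slab_fderiv_three_gauss_le m k η (zero_lt_one.trans hτ) y.1 (s * y.2)
    _ = K * T := by simp
    _ = ENNReal.ofReal (K * T).toReal :=
        (ENNReal.ofReal_toReal (ENNReal.mul_ne_top hKtop hT)).symm
    _ ≤ _ := ENNReal.ofReal_le_ofReal (by linarith)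

end
end
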